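/- arXiv:0809.2319 — 3 statements merged into one kernel-verified Lean document; each statement's English description precedes it below -/
import Mathlib

section
/- Every separating pair {a,b} of a biconnected planar graph G, with a fixed planar embedding, spans some face, i.e., there exists a face f of the embedding such that both a and b lie on the boundary of f. -/
open SimpleGraph

variable {V : Type*}

/-- `{a,b}` is a separating pair: removing both `a` and `b` disconnects the graph. -/
def SepPair (G : SimpleGraph V) (a b : V) : Prop :=
  a ≠ b ∧ ¬ (G.induce {v : V | v ≠ a ∧ v ≠ b}).Connected

/-- Two walks from `a` to `b` are internally vertex-disjoint. -/
def InternallyDisjoint (G : SimpleGraph V) {a b : V} (p q : G.Walk a b) : Prop :=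
  ∀ v : V, v ∈ p.support → v ∈ q.support → v = a ∨ v = b

/-- The pair `(a,b)` is 3-connected: there are at least three pairwise internally
vertex-disjoint paths between `a` and `b`. -/
def ThreeConnPair (G : SimpleGraph V) (a b : V) : Prop :=
  ∃ p q r : G.Path a b, InternallyDisjoint G p.1 q.1 ∧ InternallyDisjoint G p.1 r.1 ∧
    InternallyDisjoint G q.1 r.1

/-- `G` is biconnected: connected, at least 3 vertices, no articulation point. -/
def Biconnected (G : SimpleGraph V) : Prop :=
  G.Connected ∧ 3 ≤ Nat.card V ∧ ∀ v : V, (G.induce {u : V | u ≠ v}).Connected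

/-- `G` is 3-connected: at least 4 vertices and removing any at most 2 vertices
leaves it connected. -/
def ThreeConnectedGraph (G : SimpleGraph V) : Prop :=
  4 ≤ Nat.card V ∧ ∀ s : Set V, s.ncard ≤ 2 → (G.induce sᶜ).Connected

/-- Reversal of darts, as a permutation. -/
def dartRev (G : SimpleGraph V) : Equiv.Perm G.Dart :=
  ⟨SimpleGraph.Dart.symm, SimpleGraph.Dart.symm,
    fun d => SimpleGraph.Dart.symm_symm d, fun d => SimpleGraph.Dart.symm_symm d⟩

/-- A rotation scheme: a permutation of the darts fixing the tail of each dart and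
acting as a single rotation on the darts out of each vertex. -/
def RotationScheme (G : SimpleGraph V) (σ : Equiv.Perm G.Dart) : Prop :=
  (∀ d : G.Dart, (σ d).toProd.1 = d.toProd.1) ∧
    ∀ d e : G.Dart, d.toProd.1 = e.toProd.1 → ∃ n : ℕ, (σ ^ n) d = e

/-- The face-tracing permutation of a rotation scheme. -/
def facePerm (G : SimpleGraph V) (σ : Equiv.Perm G.Dart) : Equiv.Perm G.Dart :=
  (dartRev G).trans σ

/-- The faces of the combinatorial embedding, as a setoid on darts. -/
def faceSetoid (G : SimpleGraph V) (σ : Equiv.Perm G.Dart) : Setoid G.Dart :=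
  ⟨(facePerm G σ).SameCycle,
    ⟨fun x => Equiv.Perm.SameCycle.refl _ x, Equiv.Perm.SameCycle.symm,
      Equiv.Perm.SameCycle.trans⟩⟩

/-- The number of faces of the embedding given by the rotation scheme `σ`. -/
noncomputable def faceCount (G : SimpleGraph V) (σ : Equiv.Perm G.Dart) : ℕ :=
  Nat.card (Quotient (faceSetoid G σ))

/-- `σ` is a planar embedding of `G`: a rotation scheme satisfying Euler's formula. -/
def IsPlanarEmbedding (G : SimpleGraph V) (σ : Equiv.Perm G.Dart) : Prop :=
  RotationScheme G σ ∧
    (Nat.card V : ℤ) - (Nat.card G.edgeSet : ℤ) + (faceCount G σ : ℤ) = 2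

/-- `G` is planar: it admits a planar (combinatorial) embedding. -/
def HasPlanarEmbedding (G : SimpleGraph V) : Prop :=
  ∃ σ : Equiv.Perm G.Dart, IsPlanarEmbedding G σ

/-- A face of the embedding: an orbit of the face-tracing permutation. -/
def IsFace (G : SimpleGraph V) (σ : Equiv.Perm G.Dart) (f : Set G.Dart) : Prop :=
  ∃ d : G.Dart, f = {e : G.Dart | (facePerm G σ).SameCycle d e}

/-- Vertex `v` lies on the boundary of the face `f`. -/
def OnFace {G : SimpleGraph V} (f : Set G.Dart) (v : V) : Prop :=
  ∃ d ∈ f, d.toProd.1 = v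

section Helpers

attribute [local instance] Classical.propDecidable

/-- Coboundary from vertices to edges, over `ZMod 2`. -/
noncomputable def cobZero {V : Type*} (G : SimpleGraph V) :
    (V → ZMod 2) →ₗ[ZMod 2] (G.edgeSet → ZMod 2) where
  toFun h e := Sym2.lift ⟨fun u v => h u + h v, fun u v => add_comm _ _⟩ e.1
  map_add' h k := by
    ext ⟨e, he⟩
    induction e using Sym2.ind with
    | _ u v => simp only [Sym2.lift_mk, Pi.add_apply]; ring
  map_smul' c h := by
    ext ⟨e, he⟩
    induction e using Sym2.ind with
    | _ u v => simp only [Sym2.lift_mk, Pi.smul_apply, smul_eq_mul, RingHom.id_apply]; ring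

/-- The edge of a dart. -/
def dEdge {V : Type*} {G : SimpleGraph V} (d : G.Dart) : G.edgeSet := ⟨d.edge, d.edge_mem⟩

theorem cobZero_dEdge {V : Type*} {G : SimpleGraph V} (h : V → ZMod 2) (d : G.Dart) :
    cobZero G h (dEdge d) = h d.toProd.1 + h d.toProd.2 := rfl

/-- Coboundary from edges to faces, over `ZMod 2`. -/
noncomputable def cobOne {V : Type*} [Fintype V] (G : SimpleGraph V) (σ : Equiv.Perm G.Dart) :
    (G.edgeSet → ZMod 2) →ₗ[ZMod 2] (Quotient (faceSetoid G σ) → ZMod 2) where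
  toFun g q := ∑ d : G.Dart, if Quotient.mk (faceSetoid G σ) d = q then g (dEdge d) else 0
  map_add' g k := by
    ext q
    simp only [Pi.add_apply, ← Finset.sum_add_distrib]
    refine Finset.sum_congr rfl fun d _ => ?_
    split_ifs <;> simp
  map_smul' c g := by
    ext q
    simp only [Pi.smul_apply, smul_eq_mul, RingHom.id_apply, Finset.mul_sum]
    refine Finset.sum_congr rfl fun d _ => ?_
    split_ifs <;> simp

theorem facePerm_fst {V : Type*} {G : SimpleGraph V} {σ : Equiv.Perm G.Dart}
    (hσ : RotationScheme G σ) (d : G.Dart) : (facePerm G σ d).toProd.1 = d.toProd.2 :=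
  hσ.1 d.symm

theorem mk_facePerm {V : Type*} (G : SimpleGraph V) (σ : Equiv.Perm G.Dart) (d : G.Dart) :
    Quotient.mk (faceSetoid G σ) (facePerm G σ d) = Quotient.mk (faceSetoid G σ) d :=
  Quotient.sound (show (facePerm G σ).SameCycle _ _ from
    (Equiv.Perm.SameCycle.refl _ d).apply_left)

/-- Telescoping around a face. -/
theorem face_telescope {V : Type*} [Fintype V] {G : SimpleGraph V} {σ : Equiv.Perm G.Dart}
    (hσ : RotationScheme G σ) (h : V → ZMod 2) (q : Quotient (faceSetoid G σ)) :
    (∑ d : G.Dart, if Quotient.mk (faceSetoid G σ) d = q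
      then h d.toProd.1 + h d.toProd.2 else 0) = 0 := by
  have h1 : (∑ d : G.Dart, if Quotient.mk (faceSetoid G σ) d = q then h d.toProd.2 else 0)
      = ∑ d : G.Dart, if Quotient.mk (faceSetoid G σ) d = q then h d.toProd.1 else 0 := by
    rw [← Equiv.sum_comp (facePerm G σ)
      (fun d => if Quotient.mk (faceSetoid G σ) d = q then h d.toProd.1 else 0)]
    refine Finset.sum_congr rfl fun d _ => ?_
    rw [mk_facePerm, facePerm_fst hσ]
  have h2 : ∀ d : G.Dart, (if Quotient.mk (faceSetoid G σ) d = q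
      then h d.toProd.1 + h d.toProd.2 else 0) =
      (if Quotient.mk (faceSetoid G σ) d = q then h d.toProd.1 else 0) +
      (if Quotient.mk (faceSetoid G σ) d = q then h d.toProd.2 else 0) := by
    intro d; split_ifs <;> simp
  simp only [h2, Finset.sum_add_distrib, h1]
  exact CharTwo.add_self_eq_zero _

theorem range_cobZero_le {V : Type*} [Fintype V] {G : SimpleGraph V} {σ : Equiv.Perm G.Dart}
    (hσ : RotationScheme G σ) : LinearMap.range (cobZero G) ≤ LinearMap.ker (cobOne G σ) := by
  rintro _ ⟨h, rfl⟩
  rw [LinearMap.mem_ker]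
  ext q
  exact face_telescope hσ h q

theorem ker_cobZero {V : Type*} [Fintype V] {G : SimpleGraph V} (hc : G.Connected) :
    Module.finrank (ZMod 2) (LinearMap.ker (cobZero G)) ≤ 1 := by
  have hle : LinearMap.ker (cobZero G) ≤ Submodule.span (ZMod 2) {fun _ : V => (1 : ZMod 2)} := by
    intro h hh
    obtain ⟨v0⟩ := hc.nonempty
    have key : ∀ u v : V, G.Walk u v → h u = h v := by
      intro u v p
      induction p with
      | nil => rfl
      | cons hadj p ih =>
        rw [← ih]
        have := congrFun (LinearMap.mem_ker.1 hh) (dEdge ⟨(_, _), hadj⟩)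
        rw [cobZero_dEdge] at this
        exact CharTwo.add_eq_zero.1 this
    rw [Submodule.mem_span_singleton]
    refine ⟨h v0, ?_⟩
    ext v
    obtain ⟨p⟩ := hc.preconnected v0 v
    simp [key _ _ p]
  refine (Submodule.finrank_mono hle).trans ?_
  exact (finrank_span_le_card _).trans (by simp)

theorem coker_cobOne {V : Type*} [Fintype V] {G : SimpleGraph V} {σ : Equiv.Perm G.Dart}
    (hσ : RotationScheme G σ) (hc : G.Connected) (d0 : G.Dart) :
    Module.finrank (ZMod 2) (LinearMap.range (cobOne G σ)).dualAnnihilator ≤ 1 := by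
  let S : Module.Dual (ZMod 2) (Quotient (faceSetoid G σ) → ZMod 2) :=
    ∑ q, LinearMap.proj q
  have hle : (LinearMap.range (cobOne G σ)).dualAnnihilator ≤ Submodule.span (ZMod 2) {S} := by
    intro f hf
    rw [Submodule.mem_dualAnnihilator] at hf
    let y : G.Dart → ZMod 2 := fun d => f (Pi.single (Quotient.mk (faceSetoid G σ) d) 1)
    have hsymm : ∀ d : G.Dart, y d = y d.symm := by
      intro d
      have h1 : cobOne G σ (Pi.single (dEdge d) 1) =
          Pi.single (Quotient.mk (faceSetoid G σ) d) 1 +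
          Pi.single (Quotient.mk (faceSetoid G σ) d.symm) 1 := by
        ext q
        change (∑ d' : G.Dart, if Quotient.mk (faceSetoid G σ) d' = q then
          (Pi.single (dEdge d) (1 : ZMod 2) : G.edgeSet → ZMod 2) (dEdge d') else 0) = _
        rw [← Finset.sum_subset (Finset.subset_univ {d, d.symm}),
          Finset.sum_pair d.symm_ne.symm]
        · have h2 : dEdge d.symm = dEdge d := Subtype.ext d.edge_symm
          simp [h2, Pi.single_apply, eq_comm]
        · intro x _ hx
          have : dEdge x ≠ dEdge d := by
            intro h
            have h3 : x.edge = d.edge := congrArg Subtype.val h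
            rw [SimpleGraph.dart_edge_eq_iff] at h3
            simp [h3] at hx
          simp [Pi.single_eq_of_ne this]
      have h4 := hf _ ⟨Pi.single (dEdge d) 1, rfl⟩
      rw [h1, map_add] at h4
      exact CharTwo.add_eq_zero.1 h4
    have hphi : ∀ d, y (facePerm G σ d) = y d := fun d => by
      simp only [y, mk_facePerm]
    have hsig : ∀ d, y (σ d) = y d := by
      intro d
      have := hphi d.symm
      rw [← hsymm] at this
      rw [← this]
      simp [facePerm, dartRev]
    have hpow : ∀ (n : ℕ) d, y ((σ ^ n) d) = y d := by
      intro n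
      induction n with
      | zero => intro d; rfl
      | succ n ih => intro d; rw [pow_succ, Equiv.Perm.mul_apply, ih, hsig]
    have htail : ∀ d e : G.Dart, d.toProd.1 = e.toProd.1 → y d = y e := by
      intro d e h
      obtain ⟨n, rfl⟩ := hσ.2 d e h
      rw [hpow]
    have key : ∀ u v : V, G.Walk u v → ∀ d e : G.Dart, d.toProd.1 = u → e.toProd.1 = v →
        y d = y e := by
      intro u v p
      induction p with
      | nil => intro d e h1 h2; exact htail d e (h1.trans h2.symm)
      | @cons u w v hadj p ih =>
        intro d e h1 h2
        rw [htail d ⟨(u, w), hadj⟩ h1, hsymm]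
        exact ih _ _ rfl h2
    rw [Submodule.mem_span_singleton]
    refine ⟨y d0, ?_⟩
    refine LinearMap.pi_ext' fun q => LinearMap.ext_ring ?_
    obtain ⟨d, rfl⟩ := Quotient.exists_rep q
    obtain ⟨p⟩ := hc.preconnected d0.toProd.1 d.toProd.1
    have := key _ _ p d0 d rfl rfl
    simp [S, Pi.single_apply, this, y]
  refine (Submodule.finrank_mono hle).trans ?_
  exact (finrank_span_le_card _).trans (by simp)

/-- First cohomology of a planar embedding of a connected graph vanishes. -/
theorem closed_exact {V : Type*} [Fintype V] {G : SimpleGraph V} {σ : Equiv.Perm G.Dart}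
    (hσ : IsPlanarEmbedding G σ) (hc : G.Connected) (d0 : G.Dart) :
    LinearMap.range (cobZero G) = LinearMap.ker (cobOne G σ) := by
  refine Submodule.eq_of_le_of_finrank_le (range_cobZero_le hσ.1) ?_
  have h1 := LinearMap.finrank_range_add_finrank_ker (cobZero G)
  have h2 := LinearMap.finrank_range_add_finrank_ker (cobOne G σ)
  have h3 := ker_cobZero hc
  have h4 := coker_cobOne hσ.1 hc d0
  have h5 := Subspace.finrank_add_finrank_dualAnnihilator_eq (LinearMap.range (cobOne G σ))
  have h6 := hσ.2
  simp only [faceCount, Nat.card_eq_fintype_card] at h6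
  simp only [Module.finrank_fintype_fun_eq_card] at h1 h2 h5
  omega

end Helpers

/-- Every separating pair `{a,b}` of a biconnected planar graph `G` with a fixed
planar embedding spans some face: there is a face with both `a` and `b` on its boundary. -/
theorem separating_pair_spans_face {V : Type*} [Fintype V] (G : SimpleGraph V)
    (hbi : Biconnected G) (σ : Equiv.Perm G.Dart) (hσ : IsPlanarEmbedding G σ)
    (a b : V) (hsep : SepPair G a b) :
    ∃ f : Set G.Dart, IsFace G σ f ∧ OnFace f a ∧ OnFace f b := by
  classical
  by_contra hno
  obtain ⟨hc, hcard, hart⟩ := hbi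
  obtain ⟨hab, hdis⟩ := hsep
  -- no face contains both vertices
  have hface : ∀ d e : G.Dart, d.toProd.1 = a → e.toProd.1 = b →
      Quotient.mk (faceSetoid G σ) d ≠ Quotient.mk (faceSetoid G σ) e := by
    intro d e hd he h
    have hcyc : (facePerm G σ).SameCycle d e := Quotient.exact h
    exact hno ⟨_, ⟨d, rfl⟩, ⟨d, Equiv.Perm.SameCycle.refl _ d, hd⟩, ⟨e, hcyc, he⟩⟩
  -- a third vertex
  have hne : Nonempty {v : V | v ≠ a ∧ v ≠ b} := by
    by_contra hcon
    have hsub : (Finset.univ : Finset V) ⊆ {a, b} := by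
      intro v _
      by_contra hv
      simp at hv
      exact hcon ⟨⟨v, hv.1, hv.2⟩⟩
    have := (Finset.card_le_card hsub).trans Finset.card_le_two
    rw [Finset.card_univ, ← Nat.card_eq_fintype_card] at this
    omega
  have hpre : ¬ (G.induce {v : V | v ≠ a ∧ v ≠ b}).Preconnected := fun h =>
    hdis ⟨h⟩
  unfold SimpleGraph.Preconnected at hpre
  push Not at hpre
  obtain ⟨x, y, hxy⟩ := hpre
  -- `A` is the component of `x`
  let A : Set V := {v | ∃ h : v ≠ a ∧ v ≠ b,
    (G.induce {v : V | v ≠ a ∧ v ≠ b}).Reachable x ⟨v, h⟩}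
  have hxA : x.1 ∈ A := ⟨x.2, SimpleGraph.Reachable.refl _⟩
  have hyA : y.1 ∉ A := fun ⟨_, h⟩ => hxy h
  have hA : ∀ u v : V, G.Adj u v → u ∈ A → v ≠ a → v ≠ b → v ∈ A := by
    rintro u v huv ⟨hu, hr⟩ hva hvb
    refine ⟨⟨hva, hvb⟩, hr.trans (SimpleGraph.Adj.reachable ?_)⟩
    exact huv
  have haA : a ∉ A := fun ⟨h, _⟩ => h.1 rfl
  have hbA : b ∉ A := fun ⟨h, _⟩ => h.2 rfl
  -- `a` has neighbours in and outside `A`, other than `b`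
  have cross : ∀ P : Set V, (∀ u v : V, G.Adj u v → u ∈ P → v ≠ a → v ≠ b → v ∈ P) →
      ∀ s t : {u : V | u ≠ b}, s.1 ∈ P → t.1 ∉ P → a ∉ P → ∃ u ∈ P, G.Adj u a := by
    intro P hP s t hs ht haP
    obtain ⟨p⟩ := (hart b).preconnected s t
    induction p with
    | nil => exact absurd hs ht
    | @cons u v w hadj p ih =>
      by_cases hv : v.1 ∈ P
      · exact ih hv ht
      · refine ⟨u.1, hs, ?_⟩
        by_cases hva : v.1 = a
        · rw [← hva]; exact hadj
        · exact absurd (hP _ _ hadj hs hva v.2) hv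
  obtain ⟨u, huA, hua⟩ := cross A hA ⟨x.1, x.2.2⟩ ⟨a, hab⟩ hxA haA haA
  obtain ⟨w, hwB, hwa⟩ := cross {v | v ∉ A ∧ v ≠ a ∧ v ≠ b}
    (fun p q hpq hp hqa hqb => ⟨fun hq => hp.1 (hA _ _ hpq.symm hq hp.2.1 hp.2.2), hqa, hqb⟩)
    ⟨y.1, y.2.2⟩ ⟨a, hab⟩ ⟨hyA, y.2.1, y.2.2⟩ (fun h => h.2.1 rfl) (fun h => h.2.1 rfl)
  -- the cochain
  let g : G.edgeSet → ZMod 2 := fun e =>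
    if a ∈ e.1 ∧ ∃ z ∈ A, z ∈ e.1 then 1 else 0
  have hg : ∀ d : G.Dart, g (dEdge d) =
      if (d.toProd.1 = a ∧ d.toProd.2 ∈ A) ∨ (d.toProd.2 = a ∧ d.toProd.1 ∈ A)
        then 1 else 0 := by
    rintro ⟨⟨p, q⟩, hpq⟩
    simp only [g, dEdge, SimpleGraph.Dart.edge]
    refine if_congr ?_ rfl rfl
    change (a ∈ s(p, q) ∧ ∃ z ∈ A, z ∈ s(p, q)) ↔ _
    simp only [Sym2.mem_iff]
    constructor
    · rintro ⟨rfl | rfl, z, hz, rfl | rfl⟩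
      · exact absurd hz haA
      · exact Or.inl ⟨rfl, hz⟩
      · exact Or.inr ⟨rfl, hz⟩
      · exact absurd hz haA
    · rintro (⟨rfl, h⟩ | ⟨rfl, h⟩)
      · exact ⟨Or.inl rfl, q, h, Or.inr rfl⟩
      · exact ⟨Or.inr rfl, p, h, Or.inl rfl⟩
  have hclosed : g ∈ LinearMap.ker (cobOne G σ) := by
    rw [LinearMap.mem_ker]
    ext q
    change (∑ d : G.Dart, if Quotient.mk (faceSetoid G σ) d = q then g (dEdge d) else 0) = 0
    by_cases hqb : ∃ e : G.Dart, e.toProd.1 = b ∧ Quotient.mk (faceSetoid G σ) e = q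
    · obtain ⟨e, he, rfl⟩ := hqb
      refine Finset.sum_eq_zero fun d _ => ?_
      split_ifs with hd
      · rw [hg, if_neg]
        rintro (⟨h, _⟩ | ⟨h, _⟩)
        · exact hface d e h he hd
        · refine hface (facePerm G σ d) e ?_ he ?_
          · rw [facePerm_fst hσ.1, h]
          · rw [mk_facePerm, hd]
      · rfl
    · push Not at hqb
      refine Eq.trans ?_ (face_telescope hσ.1 (fun v => if v ∈ A then 1 else 0) q)
      refine Finset.sum_congr rfl fun d _ => ?_
      split_ifs with hd h1 h2 h2
      · -- both in A
        rw [hg, if_neg]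
        · rfl
        · rintro (⟨h, _⟩ | ⟨h, _⟩)
          · exact haA (h ▸ h1)
          · exact haA (h ▸ h2)
      · have hb2 : d.toProd.2 ≠ b := by
          intro h
          exact hqb (facePerm G σ d) ((facePerm_fst hσ.1 d).trans h)
            ((mk_facePerm G σ d).trans hd)
        have : d.toProd.2 = a := by
          by_contra h
          exact h2 (hA _ _ d.adj h1 h hb2)
        rw [hg, if_pos (Or.inr ⟨this, h1⟩)]
        simp
      · have hb1 : d.toProd.1 ≠ b := fun h => hqb d h hd
        have : d.toProd.1 = a := by
          by_contra h
          exact h1 (hA _ _ d.adj.symm h2 h hb1)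
        rw [hg, if_pos (Or.inl ⟨this, h2⟩)]
        simp
      · rw [hg, if_neg]
        · simp
        · tauto
      · rfl
  rw [← closed_exact hσ hc ⟨(u, a), hua⟩] at hclosed
  obtain ⟨h, hh⟩ := hclosed
  have hd : ∀ d : G.Dart, h d.toProd.1 + h d.toProd.2 = g (dEdge d) := by
    intro d
    rw [← hh, cobZero_dEdge]
  -- `h` is constant off `a`
  have hconst : ∀ s t : {v : V | v ≠ a}, h s.1 = h t.1 := by
    intro s t
    obtain ⟨p⟩ := (hart a).preconnected s t
    induction p with
    | nil => rfl
    | @cons p q r hadj _ ih =>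
      rw [← ih]
      have hadj' : G.Adj p.1 q.1 := hadj
      have := hd ⟨(p.1, q.1), hadj'⟩
      rw [hg, if_neg] at this
      · exact CharTwo.add_eq_zero.1 this
      · rintro (⟨h, _⟩ | ⟨h, _⟩)
        · exact p.2 h
        · exact q.2 h
  have e1 := hd ⟨(u, a), hua⟩
  have e2 := hd ⟨(w, a), hwa⟩
  rw [hg, if_pos (Or.inr ⟨rfl, huA⟩)] at e1
  rw [hg, if_neg] at e2
  · have e3 := hconst ⟨u, fun h => haA (h ▸ huA)⟩ ⟨w, hwB.2.1⟩
    simp only at e1 e2 e3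
    rw [e3, e2] at e1
    exact zero_ne_one e1
  · rintro (⟨h, _⟩ | ⟨_, h⟩)
    · exact hwB.2.1 h
    · exact hwB.1 h
end

section
/- In a plane biconnected graph, any two 3-connected separating pairs that span the same face are non-intersecting: if the face boundary is the cycle v_0, v_1, ..., v_k, there do not exist 3-connected separating pairs {v_i, v_j} and {v_{i'}, v_{j'}} with i < i' < j < j'. -/
open SimpleGraph

variable {V : Type*}

/-- There is a walk from `u` to `v` inside `X`. -/
def WalkIn (G : SimpleGraph V) (X : Set V) (u v : V) : Prop :=
  ∃ p : G.Walk u v, ∀ x ∈ p.support, x ∈ X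

theorem WalkIn.refl' {G : SimpleGraph V} {X : Set V} {u : V} (h : u ∈ X) : WalkIn G X u u :=
  ⟨Walk.nil, by simpa using h⟩

theorem WalkIn.trans' {G : SimpleGraph V} {X : Set V} {u v x : V} (h : WalkIn G X u v)
    (h' : WalkIn G X v x) : WalkIn G X u x := by
  obtain ⟨p, hp⟩ := h
  obtain ⟨q, hq⟩ := h'
  refine ⟨p.append q, fun y hy => ?_⟩
  rw [Walk.mem_support_append_iff] at hy
  exact hy.elim (hp y) (hq y)

theorem WalkIn.symm' {G : SimpleGraph V} {X : Set V} {u v : V} (h : WalkIn G X u v) :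
    WalkIn G X v u := by
  obtain ⟨p, hp⟩ := h
  exact ⟨p.reverse, fun y hy => hp y (by simpa using hy)⟩

theorem WalkIn.mono' {G : SimpleGraph V} {X Y : Set V} {u v : V} (h : WalkIn G X u v)
    (hXY : X ⊆ Y) : WalkIn G Y u v := by
  obtain ⟨p, hp⟩ := h
  exact ⟨p, fun y hy => hXY (hp y hy)⟩

theorem WalkIn.step' {G : SimpleGraph V} {X : Set V} {u v : V} (h : G.Adj u v)
    (hu : u ∈ X) (hv : v ∈ X) : WalkIn G X u v :=
  ⟨Walk.cons h Walk.nil, by simp [hu, hv]⟩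

theorem WalkIn.left' {G : SimpleGraph V} {X : Set V} {u v : V} (h : WalkIn G X u v) : u ∈ X := by
  obtain ⟨p, hp⟩ := h
  exact hp _ p.start_mem_support

theorem WalkIn.right' {G : SimpleGraph V} {X : Set V} {u v : V} (h : WalkIn G X u v) : v ∈ X := by
  obtain ⟨p, hp⟩ := h
  exact hp _ p.end_mem_support

theorem walkIn_of_reachable {G : SimpleGraph V} {X : Set V} {u v : X}
    (h : (G.induce X).Reachable u v) : WalkIn G X u v := by
  obtain ⟨p⟩ := h
  induction p with
  | nil => exact WalkIn.refl' (Subtype.property _)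
  | cons hadj p ih =>
    exact (WalkIn.step' (by simpa using hadj) (Subtype.property _) (Subtype.property _)).trans' ih

theorem reachable_of_walkIn {G : SimpleGraph V} {X : Set V} {u v : V}
    (h : WalkIn G X u v) : ∃ (hu : u ∈ X) (hv : v ∈ X), (G.induce X).Reachable ⟨u, hu⟩ ⟨v, hv⟩ := by
  obtain ⟨p, hp⟩ := h
  induction p with
  | nil => exact ⟨hp _ (by simp), hp _ (by simp), Reachable.refl _⟩
  | @cons a b c hadj p ih =>
    obtain ⟨h1, h2, h3⟩ := ih (fun x hx => hp x (by simp [hx]))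
    have ha : a ∈ X := hp a (by simp)
    refine ⟨ha, h2, Reachable.trans (Adj.reachable ?_) h3⟩
    simpa using hadj

/-! ### Homology part -/

section Homology

variable [Fintype V]

open Classical in
/-- Boundary map. -/
noncomputable def bdry (G : SimpleGraph V) : (G.Dart → ℚ) →ₗ[ℚ] (V → ℚ) where
  toFun c v := ∑ d : G.Dart, if d.toProd.1 = v then c d else 0
  map_add' x y := by
    funext v
    simp only [Pi.add_apply, ← Finset.sum_add_distrib]
    refine Finset.sum_congr rfl fun d _ => ?_
    split_ifs <;> simp
  map_smul' r x := by
    funext v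
    simp only [Pi.smul_apply, smul_eq_mul, RingHom.id_apply, Finset.mul_sum]
    refine Finset.sum_congr rfl fun d _ => ?_
    split_ifs <;> simp

open Classical in
/-- Elementary antisymmetric chain of a dart. -/
noncomputable def elemChain (G : SimpleGraph V) (d : G.Dart) : G.Dart → ℚ :=
  Pi.single d 1 - Pi.single d.symm 1

/-- Antisymmetric chains. -/
def antiChains (G : SimpleGraph V) : Submodule ℚ (G.Dart → ℚ) where
  carrier := {c | ∀ d, c d.symm = - c d}
  add_mem' := by
    intro a b ha hb d
    simp only [Pi.add_apply, ha d, hb d]; ring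
  zero_mem' := by intro d; simp
  smul_mem' := by
    intro r a ha d
    simp only [Pi.smul_apply, ha d, smul_eq_mul]; ring

theorem elemChain_mem (G : SimpleGraph V) (d : G.Dart) : elemChain G d ∈ antiChains G := by
  classical
  intro e
  have h1 : e.symm = d ↔ e = d.symm :=
    ⟨fun h => by rw [← h, Dart.symm_symm], fun h => by rw [h, Dart.symm_symm]⟩
  have h2 : e.symm = d.symm ↔ e = d :=
    ⟨fun h => by rw [← Dart.symm_symm e, h, Dart.symm_symm], fun h => by rw [h]⟩
  simp only [elemChain, Pi.sub_apply, Pi.single_apply, h1, h2]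
  ring

open Classical in
theorem bdry_elem (G : SimpleGraph V) (d : G.Dart) :
    bdry G (elemChain G d) = Pi.single d.toProd.1 1 - Pi.single d.toProd.2 1 := by
  funext v
  have : ∀ e : G.Dart, (if e.toProd.1 = v then elemChain G d e else 0)
      = (if e = d then (if d.toProd.1 = v then 1 else 0) else 0)
        - (if e = d.symm then (if d.toProd.2 = v then 1 else 0) else 0) := by
    intro e
    simp only [elemChain, Pi.sub_apply, Pi.single_apply]
    by_cases h1 : e = d
    · subst h1
      have : e ≠ e.symm := fun h => Dart.symm_ne e h.symm
      simp [this]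
    · by_cases h2 : e = d.symm
      · subst h2
        have : d.symm ≠ d := Dart.symm_ne d
        simp only [this, if_false, if_true]
        by_cases h : d.toProd.2 = v <;> simp [h]
      · simp [h1, h2]
  simp only [bdry, LinearMap.coe_mk, AddHom.coe_mk, this, Finset.sum_sub_distrib,
    Finset.sum_ite_eq', Finset.mem_univ, if_true, Pi.sub_apply, Pi.single_apply]
  simp only [eq_comm]

open Classical in
/-- a walk inside `X` carries a chain supported on darts with tails in `X`. -/
theorem walk_chain (G : SimpleGraph V) {X : Set V} {u v : V} (h : WalkIn G X u v) :
    ∃ c ∈ antiChains G, bdry G c = Pi.single u 1 - Pi.single v 1 ∧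
      ∀ d : G.Dart, d.toProd.1 ∉ X → c d = 0 := by
  obtain ⟨p, hp⟩ := h
  induction p with
  | nil => exact ⟨0, Submodule.zero_mem _, by simp, by simp⟩
  | @cons a b c hadj p ih =>
    obtain ⟨z, hz, hb, hs⟩ := ih (fun x hx => hp x (by simp [hx]))
    have ha : a ∈ X := hp a (by simp)
    have hbX : b ∈ X := hp b (by simp)
    refine ⟨elemChain G ⟨(a, b), hadj⟩ + z, Submodule.add_mem _ (elemChain_mem G _) hz, ?_, ?_⟩
    · rw [map_add, bdry_elem, hb]; simp
    · intro d hd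
      have h1 : d ≠ ⟨(a, b), hadj⟩ := by rintro rfl; exact hd ha
      have h2 : d ≠ (⟨(a, b), hadj⟩ : G.Dart).symm := by rintro rfl; exact hd hbX
      simp only [elemChain, Pi.add_apply, Pi.sub_apply, Pi.single_apply, h1, h2, hs d hd, if_false]
      norm_num

theorem finrank_anti (G : SimpleGraph V) :
    Module.finrank ℚ (antiChains G) ≤ Nat.card G.edgeSet := by
  classical
  have hex : ∀ e : G.edgeSet, ∃ d : G.Dart, d.edge = e := by
    rintro ⟨e, he⟩
    induction e using Sym2.ind with
    | _ x y => exact ⟨⟨(x, y), he⟩, rfl⟩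
  choose r hr using hex
  let L : antiChains G →ₗ[ℚ] (G.edgeSet → ℚ) :=
    { toFun := fun c e => c.1 (r e)
      map_add' := by intro x y; rfl
      map_smul' := by intro x y; rfl }
  have hL : Function.Injective L := by
    rw [injective_iff_map_eq_zero]
    rintro ⟨c, hc⟩ h0
    ext d
    have h1 : c (r ⟨d.edge, d.edge_mem⟩) = 0 := congrFun h0 ⟨d.edge, d.edge_mem⟩
    have h2 := hr ⟨d.edge, d.edge_mem⟩
    rcases (dart_edge_eq_iff _ _).1 h2 with h | h
    · rw [h] at h1; simpa using h1
    · rw [h, hc d] at h1; simpa using h1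
  have := LinearMap.finrank_le_finrank_of_injective hL
  rwa [Module.finrank_fintype_fun_eq_card, ← Nat.card_eq_fintype_card] at this

/-- cycles -/
noncomputable def cyc (G : SimpleGraph V) : Submodule ℚ (antiChains G) :=
  LinearMap.ker ((bdry G).comp (antiChains G).subtype)

theorem finrank_cyc (G : SimpleGraph V) (hG : G.Connected) :
    Module.finrank ℚ (cyc G) + Nat.card V ≤ Nat.card G.edgeSet + 1 := by
  classical
  obtain ⟨v0⟩ := hG.nonempty
  set B := (bdry G).comp (antiChains G).subtype with hB
  have h1 := LinearMap.finrank_range_add_finrank_ker B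
  have h2 := finrank_anti G
  let S : (V → ℚ) →ₗ[ℚ] ℚ :=
    { toFun := fun p => ∑ v, p v
      map_add' := by intro x y; simp [Finset.sum_add_distrib]
      map_smul' := by intro x y; simp [Finset.mul_sum] }
  have h3 : LinearMap.ker S ≤ LinearMap.range B := by
    intro p hp
    have hp' : ∑ v, p v = 0 := hp
    have hp2 : p = ∑ v, p v • ((Pi.single v 1 : V → ℚ) - Pi.single v0 1) := by
      simp only [smul_sub, Finset.sum_sub_distrib, ← Finset.sum_smul, hp', zero_smul, sub_zero]
      funext x
      simp [Finset.sum_apply, Pi.single_apply]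
    rw [hp2]
    refine Submodule.sum_mem _ fun v _ => Submodule.smul_mem _ _ ?_
    obtain ⟨q⟩ := hG.preconnected v v0
    obtain ⟨c, hc, hb, -⟩ := walk_chain G (X := Set.univ) ⟨q, fun _ _ => trivial⟩
    exact ⟨⟨c, hc⟩, hb⟩
  have h4 := Submodule.finrank_mono h3
  have h5 := LinearMap.finrank_range_add_finrank_ker S
  have h6 : Module.finrank ℚ (LinearMap.range S) ≤ 1 := by
    simpa using Submodule.finrank_le (LinearMap.range S)
  rw [Module.finrank_fintype_fun_eq_card, ← Nat.card_eq_fintype_card] at h5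
  change Module.finrank ℚ (LinearMap.ker B) + _ ≤ _
  omega

/-- darts are connected via rotation and reversal -/
theorem dart_const {α : Type*} (G : SimpleGraph V) (σ : Equiv.Perm G.Dart) (hσ : RotationScheme G σ)
    (Y : Set V) (g : G.Dart → α)
    (h1 : ∀ d : G.Dart, d.toProd.1 ∈ Y → g (σ d) = g d)
    (h2 : ∀ d : G.Dart, d.toProd.1 ∈ Y → g d.symm = g d)
    {u v : V} (h : WalkIn G Y u v) (d e : G.Dart) (hd : d.toProd.1 = u) (he : e.toProd.1 = v) :
    g d = g e := by
  have key : ∀ d e : G.Dart, d.toProd.1 ∈ Y → d.toProd.1 = e.toProd.1 → g d = g e := by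
    intro d e hd hde
    obtain ⟨n, hn⟩ := hσ.2 d e hde
    have : ∀ n : ℕ, g ((σ ^ n) d) = g d ∧ ((σ ^ n) d).toProd.1 = d.toProd.1 := by
      intro n
      induction n with
      | zero => simp
      | succ n ih =>
        rw [pow_succ', Equiv.Perm.mul_apply]
        exact ⟨by rw [h1 _ (by rw [ih.2]; exact hd), ih.1], by rw [hσ.1, ih.2]⟩
    rw [← hn, (this n).1]
  obtain ⟨p, hp⟩ := h
  induction p generalizing d with
  | nil => exact key d e (by rw [hd]; exact hp _ (by simp)) (hd.trans he.symm)
  | @cons a b c hadj p ih =>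
    have ha : a ∈ Y := hp a (by simp)
    rw [key d ⟨(a, b), hadj⟩ (by rw [hd]; exact ha) hd, ← h2 ⟨(a, b), hadj⟩ ha]
    exact ih _ rfl he (fun x hx => hp x (by simp [hx]))

theorem face_symm (G : SimpleGraph V) (σ : Equiv.Perm G.Dart) (d : G.Dart) :
    facePerm G σ d.symm = σ d := by
  change σ (d.symm.symm) = σ d
  rw [Dart.symm_symm]

/-- Face coboundary. -/
noncomputable def faceBd (G : SimpleGraph V) (σ : Equiv.Perm G.Dart) :
    (Quotient (faceSetoid G σ) → ℚ) →ₗ[ℚ] antiChains G where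
  toFun g := ⟨fun d => g (Quotient.mk _ d) - g (Quotient.mk _ d.symm), by
    intro d; simp only [Dart.symm_symm]; ring⟩
  map_add' x y := by ext d; simp; ring
  map_smul' r x := by ext d; simp; ring

theorem mk_face (G : SimpleGraph V) (σ : Equiv.Perm G.Dart) (d : G.Dart) :
    (Quotient.mk (faceSetoid G σ) (σ d)) = Quotient.mk (faceSetoid G σ) d.symm := by
  apply Quotient.sound
  change (facePerm G σ).SameCycle (σ d) d.symm
  rw [← face_symm]
  exact Equiv.Perm.sameCycle_apply_left.2 (Equiv.Perm.SameCycle.refl _ _)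

theorem faceBd_mem (G : SimpleGraph V) (σ : Equiv.Perm G.Dart) (hσ : RotationScheme G σ)
    (g : Quotient (faceSetoid G σ) → ℚ) : faceBd G σ g ∈ cyc G := by
  classical
  change bdry G (faceBd G σ g).1 = 0
  funext v
  change (∑ d : G.Dart, if d.toProd.1 = v then
    (g (Quotient.mk _ d) - g (Quotient.mk _ d.symm)) else 0) = 0
  have h : ∀ d : G.Dart, (if d.toProd.1 = v then
      (g (Quotient.mk _ d) - g (Quotient.mk _ d.symm)) else 0)
      = (if d.toProd.1 = v then g (Quotient.mk (faceSetoid G σ) d) else 0)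
        - (if (σ d).toProd.1 = v then g (Quotient.mk (faceSetoid G σ) (σ d)) else 0) := by
    intro d
    rw [hσ.1, mk_face]
    split_ifs <;> simp
  simp only [h, Finset.sum_sub_distrib]
  rw [Equiv.sum_comp σ
    (fun d => if d.toProd.1 = v then g (Quotient.mk (faceSetoid G σ) d) else 0), sub_self]

theorem cyc_eq_face (G : SimpleGraph V) (hG : G.Connected) (σ : Equiv.Perm G.Dart)
    (hσ : IsPlanarEmbedding G σ) (c : G.Dart → ℚ) (hc : c ∈ antiChains G) (hb : bdry G c = 0) :
    ∃ g : Quotient (faceSetoid G σ) → ℚ,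
      ∀ d, c d = g (Quotient.mk _ d) - g (Quotient.mk _ d.symm) := by
  classical
  have hle : LinearMap.range (faceBd G σ) ≤ cyc G := by
    rintro _ ⟨g, rfl⟩
    exact faceBd_mem G σ hσ.1 g
  haveI : Fintype (Quotient (faceSetoid G σ)) := Fintype.ofFinite _
  have h1 := LinearMap.finrank_range_add_finrank_ker (faceBd G σ)
  rw [Module.finrank_fintype_fun_eq_card, ← Nat.card_eq_fintype_card] at h1
  have h2 : Module.finrank ℚ (LinearMap.ker (faceBd G σ)) ≤ 1 := by
    refine finrank_le_one (R := ℚ) (M := LinearMap.ker (faceBd G σ))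
      ⟨fun _ => 1, ?_⟩ ?_
    · change faceBd G σ _ = 0
      ext d
      simp [faceBd]
    · rintro ⟨g, hg⟩
      have hg' : ∀ d : G.Dart, g (Quotient.mk _ d) - g (Quotient.mk _ d.symm) = 0 := by
        intro d
        have h0 : faceBd G σ g = 0 := hg
        exact congrFun (congrArg Subtype.val h0) d
      have hconst : ∀ d e : G.Dart,
          g (Quotient.mk (faceSetoid G σ) d) = g (Quotient.mk (faceSetoid G σ) e) := by
        intro d e
        obtain ⟨q⟩ := hG.preconnected d.toProd.1 e.toProd.1
        refine dart_const G σ hσ.1 Set.univ (fun d => g (Quotient.mk (faceSetoid G σ) d))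
          ?_ ?_ ⟨q, fun _ _ => trivial⟩ d e rfl rfl
        · intro d _
          simp only [mk_face]
          linarith [hg' d]
        · intro d _
          linarith [hg' d]
      by_cases hne : Nonempty G.Dart
      · obtain ⟨d0⟩ := hne
        refine ⟨g (Quotient.mk _ d0), ?_⟩
        ext x
        induction x using Quotient.ind with
        | _ x => simpa using hconst d0 x
      · refine ⟨0, ?_⟩
        ext x
        induction x using Quotient.ind with
        | _ x => exact absurd ⟨x⟩ hne
  have h3 := finrank_cyc G hG
  have h4 := hσ.2
  unfold faceCount at h4
  have h5 : LinearMap.range (faceBd G σ) = cyc G := by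
    refine Submodule.eq_of_le_of_finrank_le hle ?_
    omega
  have h6 : (⟨c, hc⟩ : antiChains G) ∈ cyc G := hb
  rw [← h5] at h6
  obtain ⟨g, hg⟩ := h6
  exact ⟨g, fun d => (congrFun (congrArg Subtype.val hg) d).symm⟩

/-- Two disjoint connected sets cannot cross at a face. -/
theorem crossing (G : SimpleGraph V) (hG : G.Connected) (σ : Equiv.Perm G.Dart)
    (hσ : IsPlanarEmbedding G σ) (d : G.Dart) (t2 t3 t4 : ℕ) (h02 : 0 < t2)
    (h23 : t2 < t3) (h34 : t3 < t4)
    (hinj : ∀ t < t4, ((facePerm G σ) ^ t) d ≠ ((facePerm G σ) ^ t4) d)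
    (x1 x2 x3 x4 : V) (hx1 : d.toProd.1 = x1)
    (hx2 : (((facePerm G σ) ^ t2) d).toProd.1 = x2)
    (hx3 : (((facePerm G σ) ^ t3) d).toProd.1 = x3)
    (hx4 : (((facePerm G σ) ^ t4) d).toProd.1 = x4)
    (X Y : Set V) (hXY : ∀ v ∈ X, v ∉ Y) (hX : WalkIn G X x1 x3) (hY : WalkIn G Y x2 x4) :
    False := by
  classical
  set φ := facePerm G σ with hφ
  obtain ⟨p, hp, hpb, hps⟩ := walk_chain G hX
  -- the stretch
  let s : ℕ → G.Dart → ℚ := fun n => ∑ t ∈ Finset.range n, Pi.single ((φ ^ t) d) 1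
  let cs : ℕ → G.Dart → ℚ := fun n => ∑ t ∈ Finset.range n, elemChain G ((φ ^ t) d)
  have hφtail : ∀ e : G.Dart, (φ e).toProd.1 = e.toProd.2 := by
    intro e
    change (σ e.symm).toProd.1 = _
    rw [hσ.1.1]; rfl
  have hcs : ∀ n, bdry G (cs n) = Pi.single d.toProd.1 1 - Pi.single ((φ ^ n) d).toProd.1 1 := by
    intro n
    induction n with
    | zero => simp [cs]
    | succ n ih =>
      have : cs (n + 1) = cs n + elemChain G ((φ ^ n) d) := Finset.sum_range_succ _ _
      rw [this, map_add, ih, bdry_elem, pow_succ', Equiv.Perm.mul_apply, hφtail]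
      simp
  have hcss : ∀ n e, cs n e = s n e - s n e.symm := by
    intro n e
    simp only [cs, s, Finset.sum_apply, ← Finset.sum_sub_distrib]
    refine Finset.sum_congr rfl fun t _ => ?_
    have h1 : e.symm = (φ ^ t) d ↔ e = ((φ ^ t) d).symm :=
      ⟨fun h => by rw [← h, Dart.symm_symm], fun h => by rw [h, Dart.symm_symm]⟩
    simp only [elemChain, Pi.sub_apply, Pi.single_apply, h1]
  have hs : ∀ n e, s n (φ e) + (if φ e = (φ ^ n) d then 1 else 0)
      = s n e + (if φ e = d then 1 else 0) := by
    intro n e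
    induction n with
    | zero => simp [s]
    | succ n ih =>
      have h1 : ∀ e, s (n + 1) e = s n e + (if e = (φ ^ n) d then 1 else 0) := by
        intro e
        simp only [s, Finset.sum_range_succ, Pi.add_apply, Pi.single_apply]
      have h2 : φ e = (φ ^ (n + 1)) d ↔ e = (φ ^ n) d := by
        rw [pow_succ', Equiv.Perm.mul_apply, φ.injective.eq_iff]
      rw [h1, h1, ih]
      simp only [h2]
      ring
  have hcm : p - cs t3 ∈ antiChains G :=
    Submodule.sub_mem _ hp (Submodule.sum_mem _ fun t _ => elemChain_mem G _)
  obtain ⟨g, hg⟩ := cyc_eq_face G hG σ hσ (p - cs t3) hcm (by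
    rw [map_sub, hpb, hcs, hx1, hx3, sub_self])
  let g' : G.Dart → ℚ := fun e => g (Quotient.mk _ e) + s t3 e
  have hg' : ∀ e, p e = g' e - g' e.symm := by
    intro e
    have h1 := hg e
    rw [Pi.sub_apply, hcss] at h1
    simp only [g']
    linarith
  have hsymm : ∀ e : G.Dart, e.toProd.1 ∈ Y → g' e.symm = g' e := by
    intro e he
    have h1 := hps e (fun h => hXY _ h he)
    linarith [hg' e]
  have hrot : ∀ e : G.Dart, e.toProd.1 ∈ Y → g' (σ e) = g' e := by
    intro e he
    rw [← hsymm e he]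
    simp only [g', mk_face]
    have h1 := hs t3 e.symm
    have h0 : φ e.symm = σ e := face_symm G σ e
    rw [h0] at h1
    have hn1 : σ e ≠ d := by
      intro h
      have : (σ e).toProd.1 = e.toProd.1 := hσ.1.1 e
      rw [h, hx1] at this
      exact hXY _ hX.left' (this ▸ he)
    have hn3 : σ e ≠ (φ ^ t3) d := by
      intro h
      have : (σ e).toProd.1 = e.toProd.1 := hσ.1.1 e
      rw [h, hx3] at this
      exact hXY _ hX.right' (this ▸ he)
    simp only [hn1, hn3, if_false, add_zero] at h1
    rw [h1]
  have hfin := dart_const G σ hσ.1 Y g' hrot hsymm hY _ _ hx2 hx4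
  have hq : ∀ t, (Quotient.mk (faceSetoid G σ) ((φ ^ t) d)) = Quotient.mk (faceSetoid G σ) d := by
    intro t
    apply Quotient.sound
    change φ.SameCycle _ _
    exact Equiv.Perm.sameCycle_pow_left.2 (Equiv.Perm.SameCycle.refl _ _)
  simp only [g', hq] at hfin
  have h4 : s t3 ((φ ^ t4) d) = 0 := by
    simp only [s, Finset.sum_apply]
    refine Finset.sum_eq_zero fun t ht => ?_
    rw [Finset.mem_range] at ht
    rw [Pi.single_apply, if_neg]
    exact fun h => hinj t (ht.trans h34) h.symm
  have h2 : 1 ≤ s t3 ((φ ^ t2) d) := by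
    simp only [s, Finset.sum_apply]
    have := Finset.single_le_sum
      (f := fun t => (Pi.single ((φ ^ t) d) 1 : G.Dart → ℚ) ((φ ^ t2) d))
      (s := Finset.range t3) (fun t _ => by
        simp only [Pi.single_apply]; split_ifs <;> norm_num) (Finset.mem_range.2 h23)
    simpa using this
  linarith

end Homology

/-! ### Graph part -/

theorem threeconn_avoid (G : SimpleGraph V) {a b c d : V} (h : ThreeConnPair G a b)
    (hca : c ≠ a) (hcb : c ≠ b) (hda : d ≠ a) (hdb : d ≠ b) :
    WalkIn G {v | v ≠ c ∧ v ≠ d} a b := by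
  obtain ⟨p, q, r, hpq, hpr, hqr⟩ := h
  have good : ∀ p : G.Path a b, c ∉ p.1.support → d ∉ p.1.support →
      WalkIn G {v | v ≠ c ∧ v ≠ d} a b := fun p hc hd =>
    ⟨p.1, fun x hx => ⟨fun h => hc (h ▸ hx), fun h => hd (h ▸ hx)⟩⟩
  have c1 : c ∈ p.1.support → c ∉ q.1.support := fun x y => (hpq c x y).elim hca hcb
  have c2 : c ∈ p.1.support → c ∉ r.1.support := fun x y => (hpr c x y).elim hca hcb
  have c3 : c ∈ q.1.support → c ∉ r.1.support := fun x y => (hqr c x y).elim hca hcb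
  have d1 : d ∈ p.1.support → d ∉ q.1.support := fun x y => (hpq d x y).elim hda hdb
  have d2 : d ∈ p.1.support → d ∉ r.1.support := fun x y => (hpr d x y).elim hda hdb
  have d3 : d ∈ q.1.support → d ∉ r.1.support := fun x y => (hqr d x y).elim hda hdb
  by_cases pc : c ∈ p.1.support
  · by_cases qd : d ∈ q.1.support
    · exact good r (c2 pc) (d3 qd)
    · exact good q (c1 pc) qd
  · by_cases pd : d ∈ p.1.support
    · by_cases qc : c ∈ q.1.support
      · exact good r (c3 qc) (d2 pd)
      · exact good q qc (d1 pd)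
    · exact good p pc pd

theorem walk_to (G : SimpleGraph V) {K : Set V} {a b : V}
    (hK : ∀ x ∈ K, ∀ y, G.Adj x y → y ≠ a → y ≠ b → y ∈ K)
    {x : V} (hx : x ∈ K) (h : WalkIn G {v | v ≠ b} x a) : WalkIn G (insert a K) x a := by
  obtain ⟨p, hp⟩ := h
  induction p with
  | nil => exact WalkIn.refl' (by simp)
  | @cons x y a hadj p ih =>
    by_cases hya : y = a
    · subst hya
      exact WalkIn.step' hadj (by simp [hx]) (by simp)
    · have hy : y ∈ K := hK x hx y hadj hya (hp y (by simp))
      exact (WalkIn.step' hadj (by simp [hx]) (by simp [hy])).trans'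
        (ih hK hy (fun z hz => hp z (by simp [hz])))

/-- The extra component. -/
theorem extra_comp (G : SimpleGraph V) (hbi : Biconnected G) {a b c d : V}
    (hsep : SepPair G a b) (hQ : WalkIn G {v | v ≠ a ∧ v ≠ b} c d) :
    ∃ K : Set V, (∀ x ∈ K, ∀ y, G.Adj x y → y ≠ a → y ≠ b → y ∈ K) ∧ K.Nonempty ∧
      a ∉ K ∧ b ∉ K ∧ c ∉ K ∧ d ∉ K ∧ (∀ x ∈ K, WalkIn G (insert a K) x a) ∧
      (∀ x ∈ K, WalkIn G (insert b K) x b) := by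
  obtain ⟨hab, hnc⟩ := hsep
  have hex : ∃ u : V, (u ≠ a ∧ u ≠ b) ∧ ¬ WalkIn G {v | v ≠ a ∧ v ≠ b} c u := by
    by_contra hcon
    push Not at hcon
    apply hnc
    haveI : Nonempty {v : V | v ≠ a ∧ v ≠ b} := ⟨⟨c, hQ.left'⟩⟩
    refine Connected.mk ?_
    rintro ⟨x, hx⟩ ⟨y, hy⟩
    obtain ⟨_, _, h⟩ := reachable_of_walkIn ((hcon x hx).symm'.trans' (hcon y hy))
    exact h
  obtain ⟨u, hu, hcu⟩ := hex
  have hKcl : ∀ x ∈ {v | WalkIn G {v | v ≠ a ∧ v ≠ b} u v}, ∀ y, G.Adj x y → y ≠ a → y ≠ b →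
      y ∈ {v | WalkIn G {v | v ≠ a ∧ v ≠ b} u v} := by
    intro x hx y hxy ha hb
    exact WalkIn.trans' hx (WalkIn.step' hxy (WalkIn.right' hx) ⟨ha, hb⟩)
  have bic : ∀ x y v : V, x ≠ v → y ≠ v → WalkIn G {u | u ≠ v} x y := by
    intro x y v hx hy
    exact walkIn_of_reachable ((hbi.2.2 v).preconnected ⟨x, hx⟩ ⟨y, hy⟩)
  refine ⟨{v | WalkIn G {v | v ≠ a ∧ v ≠ b} u v}, hKcl, ⟨u, WalkIn.refl' hu⟩,
    fun h => (WalkIn.right' h).1 rfl, fun h => (WalkIn.right' h).2 rfl,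
    fun h => hcu (WalkIn.symm' h), fun h => hcu (hQ.trans' (WalkIn.symm' h)), ?_, ?_⟩
  · intro x hx
    exact walk_to G hKcl hx (bic x a b (WalkIn.right' hx).2 hab)
  · intro x hx
    exact walk_to G (fun x hx y hxy h1 h2 => hKcl x hx y hxy h2 h1) hx
      (bic x b a (WalkIn.right' hx).1 hab.symm)

theorem stays (G : SimpleGraph V) {K : Set V} {c d : V}
    (hK : ∀ x ∈ K, ∀ y, G.Adj x y → y ≠ c → y ≠ d → y ∈ K) {x y : V} (hx : x ∈ K)
    (h : WalkIn G {v | v ≠ c ∧ v ≠ d} x y) : y ∈ K := by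
  obtain ⟨p, hp⟩ := h
  induction p with
  | nil => exact hx
  | @cons x y z hadj p ih =>
    have := hp y (by simp)
    exact ih (hK x hx y hadj this.1 this.2) (fun z hz => hp z (by simp [hz]))

theorem disjoint_connectors (G : SimpleGraph V) (hbi : Biconnected G) {a b c d : V}
    (hca : c ≠ a) (hcb : c ≠ b) (hda : d ≠ a) (hdb : d ≠ b)
    (h1 : SepPair G a b) (h1' : ThreeConnPair G a b)
    (h2 : SepPair G c d) (h2' : ThreeConnPair G c d) :
    ∃ X Y : Set V, (∀ v ∈ X, v ∉ Y) ∧ WalkIn G X a b ∧ WalkIn G Y c d := by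
  have hP := threeconn_avoid G h1' hca hcb hda hdb
  have hQ := threeconn_avoid G h2' hca.symm hda.symm hcb.symm hdb.symm
  obtain ⟨K, hK, ⟨u, hu⟩, haK, hbK, hcK, hdK, hKa, hKb⟩ := extra_comp G hbi h1 hQ
  obtain ⟨L, hL, ⟨v, hv⟩, hcL, hdL, haL, hbL, hLc, hLd⟩ := extra_comp G hbi h2 hP
  have hdis : ∀ x ∈ K, x ∉ L := by
    intro x hxK hxL
    refine haL (stays G hL hxL ((hKa x hxK).mono' ?_))
    intro y hy
    rcases hy with rfl | hy
    · exact ⟨hca.symm, hda.symm⟩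
    · exact ⟨fun h => hcK (h ▸ hy), fun h => hdK (h ▸ hy)⟩
  refine ⟨insert a (insert b K), insert c (insert d L), ?_, ?_, ?_⟩
  · rintro x (rfl | rfl | hx) (rfl | rfl | hy)
    all_goals first | contradiction | exact hdis x hx hy
  · exact ((hKa u hu).symm'.mono' (Set.insert_subset_insert (Set.subset_insert _ _))).trans'
      ((hKb u hu).mono' (Set.subset_insert _ _))
  · exact ((hLc v hv).symm'.mono' (Set.insert_subset_insert (Set.subset_insert _ _))).trans'
      ((hLd v hv).mono' (Set.subset_insert _ _))

theorem arc (G : SimpleGraph V) {k : ℕ} (w : Fin (k + 1) → V)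
    (hcyc : ∀ i : Fin (k + 1), G.Adj (w i) (w (i + 1))) (s : ℕ) (hs : s < k + 1) (t : ℕ)
    (hst : s ≤ t) (ht : t < k + 1) :
    WalkIn G {v | ∃ x : Fin (k + 1), w x = v ∧ s ≤ x.1 ∧ x.1 ≤ t} (w ⟨s, hs⟩) (w ⟨t, ht⟩) := by
  induction t, hst using Nat.le_induction with
  | base => exact WalkIn.refl' ⟨_, rfl, le_rfl, le_rfl⟩
  | succ t hst ih =>
    have ht' : t < k + 1 := by omega
    have hadj := hcyc ⟨t, ht'⟩
    have he : (⟨t, ht'⟩ : Fin (k + 1)) + 1 = ⟨t + 1, ht⟩ := by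
      apply Fin.ext
      rw [Fin.val_add_one_of_lt]
      rw [Fin.lt_def]; simp; omega
    rw [he] at hadj
    refine ((ih ht').mono' ?_).trans' (WalkIn.step' hadj ⟨_, rfl, hst, by simp⟩
      ⟨_, rfl, by simp; omega, by simp⟩)
    rintro v ⟨x, hx, h1, h2⟩
    exact ⟨x, hx, h1, by omega⟩

/-- In a plane biconnected graph, any two 3-connected separating pairs spanning the
same face are non-intersecting: if `w 0, ..., w k` lists the boundary cycle of a face
`f`, there are no 3-connected separating pairs `{w i, w j}` and `{w i', w j'}` with
`i < i' < j < j'`. -/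
theorem threeconn_sep_pairs_nonintersecting {V : Type*} [Fintype V] (G : SimpleGraph V)
    (hbi : Biconnected G) (σ : Equiv.Perm G.Dart) (hσ : IsPlanarEmbedding G σ)
    (f : Set G.Dart) (hf : IsFace G σ f)
    (k : ℕ) (w : Fin (k + 1) → V) (hinj : Function.Injective w)
    (hcyc : ∀ i : Fin (k + 1), G.Adj (w i) (w (i + 1)))
    (hbound : ∀ v : V, OnFace f v ↔ ∃ i, w i = v) :
    ¬ ∃ i i' j j' : Fin (k + 1), i < i' ∧ i' < j ∧ j < j' ∧
        (SepPair G (w i) (w j) ∧ ThreeConnPair G (w i) (w j)) ∧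
        (SepPair G (w i') (w j') ∧ ThreeConnPair G (w i') (w j')) := by
  rintro ⟨i, i', j, j', h1, h2, h3, ⟨hs1, ht1⟩, hs2, ht2⟩
  have ne : ∀ {x y : Fin (k + 1)}, x < y → w x ≠ w y := fun h h' => h.ne (hinj h')
  have hca := (ne h1).symm
  have hcb := ne h2
  have hda := (ne (h1.trans (h2.trans h3))).symm
  have hdb := (ne h3).symm
  obtain ⟨X, Y, hXY, hX, hY⟩ := disjoint_connectors G hbi hca hcb hda hdb hs1 ht1 hs2 ht2
  -- the arcs of the cycle
  have arcs : ∀ s t : Fin (k + 1), s ≤ t →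
      WalkIn G {v | ∃ x : Fin (k + 1), w x = v ∧ s.1 ≤ x.1 ∧ x.1 ≤ t.1} (w s) (w t) :=
    fun s t h => arc G w hcyc s.1 s.2 t.1 h t.2
  have a1 := arcs i i' h1.le
  have a2 := arcs j j' h3.le
  have a3 := arcs i' j h2.le
  have a4 : WalkIn G {v | ∃ x : Fin (k + 1), w x = v ∧ (x.1 ≤ i.1 ∨ j'.1 ≤ x.1)} (w j') (w i) := by
    have e1 := arcs j' (Fin.last k) (Fin.le_last _)
    have e2 := arcs 0 i (Fin.zero_le _)
    have hadj := hcyc (Fin.last k)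
    rw [Fin.last_add_one] at hadj
    have e3 : WalkIn G {v | ∃ x : Fin (k + 1), w x = v ∧ (x.1 ≤ i.1 ∨ j'.1 ≤ x.1)}
        (w (Fin.last k)) (w 0) :=
      WalkIn.step' hadj ⟨_, rfl, Or.inr (Fin.le_last j')⟩ ⟨_, rfl, Or.inl (by simp)⟩
    refine (e1.mono' ?_).trans' (e3.trans' (e2.mono' ?_))
    · rintro v ⟨x, hx, h1, h2⟩
      exact ⟨x, hx, Or.inr h1⟩
    · rintro v ⟨x, hx, h1, h2⟩
      exact ⟨x, hx, Or.inl h2⟩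
  have D12 : ∀ v ∈ {v | ∃ x : Fin (k + 1), w x = v ∧ i.1 ≤ x.1 ∧ x.1 ≤ i'.1},
      v ∉ {v | ∃ x : Fin (k + 1), w x = v ∧ j.1 ≤ x.1 ∧ x.1 ≤ j'.1} := by
    rintro v ⟨x, hx, e1, e2⟩ ⟨y, hy, e3, e4⟩
    have := hinj (hx.trans hy.symm)
    subst this
    rw [Fin.lt_def] at h1 h2 h3
    omega
  have D43 : ∀ v ∈ {v | ∃ x : Fin (k + 1), w x = v ∧ (x.1 ≤ i.1 ∨ j'.1 ≤ x.1)},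
      v ∉ {v | ∃ x : Fin (k + 1), w x = v ∧ i'.1 ≤ x.1 ∧ x.1 ≤ j.1} := by
    rintro v ⟨x, hx, e1⟩ ⟨y, hy, e3, e4⟩
    have := hinj (hx.trans hy.symm)
    subst this
    rw [Fin.lt_def] at h1 h2 h3
    omega
  -- darts on the face
  obtain ⟨d0, rfl⟩ := hf
  have getd : ∀ x, ∃ d : G.Dart, (facePerm G σ).SameCycle d0 d ∧ d.toProd.1 = w x := by
    intro x
    obtain ⟨d, hd, hd'⟩ := (hbound (w x)).2 ⟨x, rfl⟩
    exact ⟨d, hd, hd'⟩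
  obtain ⟨da, hda0, hta⟩ := getd i
  have pos : ∀ x, ∃ t : ℕ, (((facePerm G σ) ^ t) da).toProd.1 = w x ∧
      ∀ s < t, ((facePerm G σ) ^ s) da ≠ ((facePerm G σ) ^ t) da := by
    intro x
    classical
    obtain ⟨d, hd, hd'⟩ := getd x
    have hex : ∃ t : ℕ, ((facePerm G σ) ^ t) da = d := by
      obtain ⟨t, -, ht⟩ := (hda0.symm.trans hd).exists_pow_eq'
      exact ⟨t, ht⟩
    refine ⟨Nat.find hex, by rw [Nat.find_spec hex]; exact hd', fun s hs h => ?_⟩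
    exact Nat.find_min hex hs (h.trans (Nat.find_spec hex))
  obtain ⟨tb, hb, hbm⟩ := pos j
  obtain ⟨tc, hc, hcm⟩ := pos i'
  obtain ⟨td, hd, hdm⟩ := pos j'
  have hG := hbi.1
  have z : ∀ t x, (((facePerm G σ) ^ t) da).toProd.1 = w x → w x ≠ w i → 0 < t := by
    intro t x h hne
    rcases Nat.eq_zero_or_pos t with rfl | h'
    · exact absurd (h.symm.trans hta) hne
    · exact h'
  have zb := z tb j hb hs1.1.symm
  have zc := z tc i' hc hca
  have zd := z td j' hd hda
  have nbc : tb ≠ tc := by rintro rfl; exact hcb (hc.symm.trans hb)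
  have nbd : tb ≠ td := by rintro rfl; exact hdb (hd.symm.trans hb)
  have ncd : tc ≠ td := by rintro rfl; exact hs2.1 (hc.symm.trans hd)
  rcases lt_or_gt_of_ne nbc with l1 | l1 <;> rcases lt_or_gt_of_ne nbd with l2 | l2 <;>
    rcases lt_or_gt_of_ne ncd with l3 | l3
  · exact crossing G hG σ hσ da tb tc td zb l1 l3 hdm _ _ _ _ hta hb hc hd _ _ D12 a1 a2
  · exact crossing G hG σ hσ da tb td tc zb l2 l3 hcm _ _ _ _ hta hb hd hc _ _ D43 a4.symm' a3.symm'
  · omega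
  · exact crossing G hG σ hσ da td tb tc zd l2 l1 hcm _ _ _ _ hta hd hb hc _ _ hXY hX hY.symm'
  · exact crossing G hG σ hσ da tc tb td zc l1 l2 hdm _ _ _ _ hta hc hb hd _ _ hXY hX hY
  · omega
  · exact crossing G hG σ hσ da tc td tb zc l3 l2 hbm _ _ _ _ hta hc hd hb _ _ D43 a4.symm' a3
  · exact crossing G hG σ hσ da td tc tb zd l3 l1 hbm _ _ _ _ hta hd hc hb _ _ D12 a1 a2.symm'
end

section
/- Let G be a 3-connected planar graph with at least 3 vertices each given a distinct color. Then G has at most one non-trivial color-preserving automorphism; equivalently, the group of color-preserving automorphisms of G has order at most 2. -/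
open SimpleGraph

variable {V : Type*}

abbrev CycQ {D : Type*} (π : Equiv.Perm D) := Quotient (Equiv.Perm.SameCycle.setoid π)

/-- transitivity of the group generated by two permutations -/
def TransPair {D : Type*} (s a : Equiv.Perm D) : Prop :=
  ∀ P : D → Prop, (∀ d, P (s d) ↔ P d) → (∀ d, P (a d) ↔ P d) → ∀ d e, P d → P e

theorem TransPair.const {D β : Type*} {s a : Equiv.Perm D} (h : TransPair s a) (t : D → β)
    (hs : ∀ d, t (s d) = t d) (ha : ∀ d, t (a d) = t d) (d e : D) : t e = t d :=
  h (fun x => t x = t d) (fun x => by rw [hs]) (fun x => by rw [ha]) d e rfl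

set_option linter.unusedSectionVars false
section lin
open Classical

variable {D : Type*} [Fintype D]

noncomputable def incM (s a : Equiv.Perm D) :
    Matrix (D ⊕ D) (CycQ s ⊕ (CycQ a ⊕ CycQ (s * a))) (ZMod 2) := fun i j =>
  match i, j with
  | .inl d, .inl c => if (Quotient.mk _ d : CycQ s) = c then 1 else 0
  | .inl _, .inr (.inl _) => 0
  | .inl d, .inr (.inr c) => if (Quotient.mk _ (a.symm d) : CycQ (s * a)) = c then 1 else 0
  | .inr _, .inl _ => 0
  | .inr d, .inr (.inl c) => if (Quotient.mk _ d : CycQ a) = c then 1 else 0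
  | .inr d, .inr (.inr c) => if (Quotient.mk _ d : CycQ (s * a)) = c then 1 else 0

theorem incM_inl (s a : Equiv.Perm D) (x : CycQ s ⊕ (CycQ a ⊕ CycQ (s * a)) → ZMod 2) (d : D) :
    (incM s a).mulVec x (.inl d) = x (.inl (Quotient.mk _ d)) +
      x (.inr (.inr (Quotient.mk _ (a.symm d)))) := by
  simp [Matrix.mulVec, dotProduct, incM, Fintype.sum_sum_type]

theorem incM_inr (s a : Equiv.Perm D) (x : CycQ s ⊕ (CycQ a ⊕ CycQ (s * a)) → ZMod 2) (d : D) :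
    (incM s a).mulVec x (.inr d) = x (.inr (.inl (Quotient.mk _ d))) +
      x (.inr (.inr (Quotient.mk _ d))) := by
  simp [Matrix.mulVec, dotProduct, incM, Fintype.sum_sum_type]

theorem cyc_mk_eq {π : Equiv.Perm D} {x y : D} :
    ((Quotient.mk _ x : CycQ π) = Quotient.mk _ y) ↔ π.SameCycle x y :=
  Quotient.eq (r := Equiv.Perm.SameCycle.setoid π)

theorem cyc_mk_apply (π : Equiv.Perm D) (x : D) :
    (Quotient.mk _ (π x) : CycQ π) = Quotient.mk _ x := by
  rw [cyc_mk_eq]; simp [Equiv.Perm.SameCycle.refl]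

theorem incM_ker (s a : Equiv.Perm D) (hT : TransPair s a) :
    Module.finrank (ZMod 2) (LinearMap.ker (incM s a).mulVecLin) ≤ 1 := by
  rcases isEmpty_or_nonempty D with hE | ⟨⟨d0⟩⟩
  · have : IsEmpty (CycQ s ⊕ (CycQ a ⊕ CycQ (s * a))) := by
      have h (π : Equiv.Perm D) : IsEmpty (CycQ π) :=
        ⟨fun c => Quotient.inductionOn c (fun d => hE.elim d)⟩
      have := h s; have := h a; have := h (s * a)
      infer_instance
    rw [Module.finrank_zero_of_subsingleton]
    exact Nat.zero_le _
  · let w : CycQ s ⊕ (CycQ a ⊕ CycQ (s * a)) → ZMod 2 := fun j => 1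
    have hle : LinearMap.ker (incM s a).mulVecLin ≤ Submodule.span (ZMod 2) {w} := by
      intro x hx
      rw [LinearMap.mem_ker, Matrix.mulVecLin_apply] at hx
      have h1 (d) : x (.inl (Quotient.mk _ d)) = x (.inr (.inr (Quotient.mk _ (a.symm d)))) := by
        have := congrFun hx (.inl d)
        rw [incM_inl] at this
        exact CharTwo.add_eq_zero.1 this
      have h2 (d) : x (.inr (.inl (Quotient.mk _ d))) = x (.inr (.inr (Quotient.mk _ d))) := by
        have := congrFun hx (.inr d)
        rw [incM_inr] at this
        exact CharTwo.add_eq_zero.1 this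
      let t : D → ZMod 2 := fun d => x (.inr (.inr (Quotient.mk _ d)))
      have ha (d) : t (a d) = t d := by
        simp only [t]; rw [← h2, ← h2, cyc_mk_apply]
      have hs (d) : t (s d) = t d := by
        have e : (Quotient.mk _ (s d) : CycQ (s * a)) = Quotient.mk _ (a.symm d) := by
          have := cyc_mk_apply (s * a) (a.symm d)
          simpa using this
        have : t (s d) = t (a.symm d) := by simp only [t]; rw [e]
        rw [this, ← ha]; simp
      have hc := hT.const t hs ha d0
      rw [Submodule.mem_span_singleton]
      refine ⟨t d0, ?_⟩
      funext j
      simp only [w, Pi.smul_apply, smul_eq_mul, mul_one]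
      rcases j with c | c | c <;> induction c using Quotient.inductionOn with | _ d
      · rw [h1]; exact (hc _).symm
      · rw [h2]; exact (hc _).symm
      · exact (hc _).symm
    exact (Submodule.finrank_mono hle).trans ((finrank_span_le_card ({w} : Set _)).trans (by simp))

/-- coboundary -/
def cobd (s a : Equiv.Perm D) : (D → ZMod 2) →ₗ[ZMod 2] (D ⊕ D → ZMod 2) where
  toFun t := Sum.elim (fun d => t (s d) - t d) (fun d => t (a d) - t d)
  map_add' x y := by funext i; rcases i with d | d <;> simp <;> ring
  map_smul' c x := by funext i; rcases i with d | d <;> simp <;> ring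

theorem cobd_ker (s a : Equiv.Perm D) (hT : TransPair s a) :
    Module.finrank (ZMod 2) (LinearMap.ker (cobd s a)) ≤ 1 := by
  rcases isEmpty_or_nonempty D with hE | ⟨⟨d0⟩⟩
  · rw [Module.finrank_zero_of_subsingleton]
    exact Nat.zero_le _
  · have hle : LinearMap.ker (cobd s a) ≤ Submodule.span (ZMod 2) {fun _ : D => (1 : ZMod 2)} := by
      intro t ht
      rw [LinearMap.mem_ker] at ht
      have hs (d) : t (s d) = t d := sub_eq_zero.1 (congrFun ht (.inl d))
      have ha (d) : t (a d) = t d := sub_eq_zero.1 (congrFun ht (.inr d))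
      rw [Submodule.mem_span_singleton]
      refine ⟨t d0, ?_⟩
      funext d
      simp [hT.const t hs ha d0 d]
    exact (Submodule.finrank_mono hle).trans ((finrank_span_le_card ({fun _ : D => (1 : ZMod 2)} : Set _)).trans (by simp))

theorem incMT_inl (s a : Equiv.Perm D) (p : D ⊕ D → ZMod 2) (x : D) :
    (incM s a).transpose.mulVec p (.inl (Quotient.mk _ x)) =
      ∑ d with s.SameCycle x d, p (.inl d) := by
  simp only [Matrix.mulVec, dotProduct, incM, Fintype.sum_sum_type, Matrix.transpose_apply,
    cyc_mk_eq, Finset.sum_filter]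
  simp [Equiv.Perm.sameCycle_comm]

theorem incMT_inr (s a : Equiv.Perm D) (p : D ⊕ D → ZMod 2) (x : D) :
    (incM s a).transpose.mulVec p (.inr (.inl (Quotient.mk _ x))) =
      ∑ d with a.SameCycle x d, p (.inr d) := by
  simp only [Matrix.mulVec, dotProduct, incM, Fintype.sum_sum_type, Matrix.transpose_apply,
    cyc_mk_eq, Finset.sum_filter]
  simp [Equiv.Perm.sameCycle_comm]

theorem incMT_inrr (s a : Equiv.Perm D) (p : D ⊕ D → ZMod 2) (x : D) :
    (incM s a).transpose.mulVec p (.inr (.inr (Quotient.mk _ x))) =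
      ∑ d with (s * a).SameCycle x d, (p (.inr d) + p (.inl (a d))) := by
  simp only [Matrix.mulVec, dotProduct, incM, Fintype.sum_sum_type, Matrix.transpose_apply,
    cyc_mk_eq, Finset.sum_filter]
  rw [← Equiv.sum_comp a]
  rw [← Finset.sum_add_distrib]
  refine Finset.sum_congr rfl fun d _ => ?_
  rw [Equiv.symm_apply_apply]
  by_cases h : (s * a).SameCycle x d
  · simp [h, h.symm, add_comm]
  · simp [h, mt Equiv.Perm.SameCycle.symm h]

theorem sum_cycle_comp (π : Equiv.Perm D) (t : D → ZMod 2) (x : D) :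
    ∑ d with π.SameCycle x d, (t (π d) - t d) = 0 := by
  rw [Finset.sum_sub_distrib, sub_eq_zero]
  simp only [Finset.sum_filter]
  rw [← Equiv.sum_comp π (fun d => if π.SameCycle x d then t d else 0)]
  simp

theorem cobd_range_le (s a : Equiv.Perm D) :
    LinearMap.range (cobd s a) ≤ LinearMap.ker (incM s a).transpose.mulVecLin := by
  rintro _ ⟨t, rfl⟩
  rw [LinearMap.mem_ker, Matrix.mulVecLin_apply]
  funext j
  rcases j with c | c | c <;> induction c using Quotient.inductionOn with | _ x
  · rw [incMT_inl]; exact sum_cycle_comp s t x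
  · rw [incMT_inr]; exact sum_cycle_comp a t x
  · rw [incMT_inrr]
    refine Eq.trans ?_ (sum_cycle_comp (s * a) t x)
    simp [cobd]

theorem cyc_dims (s a : Equiv.Perm D) (hT : TransPair s a) :
    Fintype.card D ≤ Module.finrank (ZMod 2) (LinearMap.range (cobd s a)) + 1 ∧
    Module.finrank (ZMod 2) (LinearMap.ker (incM s a).transpose.mulVecLin) +
      (Nat.card (CycQ s) + Nat.card (CycQ a) + Nat.card (CycQ (s * a))) ≤
      2 * Fintype.card D + 1 := by
  have h1 := LinearMap.finrank_range_add_finrank_ker (cobd s a)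
  have h2 := LinearMap.finrank_range_add_finrank_ker (incM s a).mulVecLin
  have h3 := LinearMap.finrank_range_add_finrank_ker (incM s a).transpose.mulVecLin
  have h4 := Matrix.rank_transpose (incM s a)
  rw [Matrix.rank, Matrix.rank] at h4
  have h5 := incM_ker s a hT
  have h6 := cobd_ker s a hT
  rw [Module.finrank_eq_card_basis (Pi.basisFun _ _)] at h1 h2 h3
  simp only [Fintype.card_sum] at *
  simp only [Nat.card_eq_fintype_card] at *
  omega

theorem cyc_count (s a : Equiv.Perm D) (hT : TransPair s a) :
    Nat.card (CycQ s) + Nat.card (CycQ a) + Nat.card (CycQ (s * a)) ≤ Nat.card D + 2 := by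
  have h := cyc_dims s a hT
  have h2 := Submodule.finrank_mono (cobd_range_le s a)
  rw [Nat.card_eq_fintype_card (α := D)]
  omega

theorem cyc_cohom (s a : Equiv.Perm D) (hT : TransPair s a)
    (hE : Nat.card (CycQ s) + Nat.card (CycQ a) + Nat.card (CycQ (s * a)) = Nat.card D + 2)
    (p q : D → ZMod 2)
    (hs : ∀ u : D → ZMod 2, (∀ d, u (s d) = u d) → ∑ d, u d * p d = 0)
    (ha : ∀ u : D → ZMod 2, (∀ d, u (a d) = u d) → ∑ d, u d * q d = 0)
    (hf : ∀ u : D → ZMod 2, (∀ d, u ((s * a) d) = u d) → ∑ d, u d * (q d + p (a d)) = 0) :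
    ∃ t : D → ZMod 2, (∀ d, t (s d) = t d + p d) ∧ (∀ d, t (a d) = t d + q d) := by
  have h := cyc_dims s a hT
  rw [Nat.card_eq_fintype_card (α := D)] at hE
  have heq := Submodule.eq_of_le_of_finrank_le (cobd_range_le s a) (by omega)
  have hm : Sum.elim p q ∈ LinearMap.ker (incM s a).transpose.mulVecLin := by
    rw [LinearMap.mem_ker, Matrix.mulVecLin_apply]
    funext j
    rcases j with c | c | c <;> induction c using Quotient.inductionOn with | _ x
    · rw [incMT_inl]
      have := hs (fun d => if s.SameCycle x d then 1 else 0) (by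
        intro d; simp only [Equiv.Perm.sameCycle_apply_right])
      rw [Finset.sum_filter]
      simpa using this
    · rw [incMT_inr]
      have := ha (fun d => if a.SameCycle x d then 1 else 0) (by
        intro d; simp only [Equiv.Perm.sameCycle_apply_right])
      rw [Finset.sum_filter]
      simpa using this
    · rw [incMT_inrr]
      have := hf (fun d => if (s * a).SameCycle x d then 1 else 0) (by
        intro d; simp only [Equiv.Perm.sameCycle_apply_right])
      rw [Finset.sum_filter]
      simpa using this
  rw [← heq] at hm
  obtain ⟨t, ht⟩ := hm
  refine ⟨t, fun d => ?_, fun d => ?_⟩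
  · have := congrFun ht (.inl d)
    exact sub_eq_iff_eq_add'.1 this
  · have := congrFun ht (.inr d)
    exact sub_eq_iff_eq_add'.1 this

end lin
section rigid
open Classical

variable {D : Type*} [Fintype D]

theorem comm_sameCycle {π φ : Equiv.Perm D} (h : Commute φ π) (x y : D) :
    φ.SameCycle x y ↔ φ.SameCycle (π x) (π y) := by
  have e : π * φ * π⁻¹ = φ := by rw [← h.eq]; simp
  have := Equiv.Perm.sameCycle_conj (f := φ) (g := π) (x := π x) (y := π y)
  rw [e] at this
  simpa using this.symm

def qperm (π φ : Equiv.Perm D) (h : Commute φ π) : Equiv.Perm (CycQ φ) :=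
  Quotient.congr π (fun x y => comm_sameCycle h x y)

theorem qperm_mk (π φ : Equiv.Perm D) (h : Commute φ π) (x : D) :
    qperm π φ h (Quotient.mk _ x) = Quotient.mk _ (π x) := rfl

theorem qperm_pow_mk (π φ : Equiv.Perm D) (h : Commute φ π) (n : ℕ) (x : D) :
    (qperm π φ h ^ n) (Quotient.mk _ x) = Quotient.mk _ ((π ^ n) x) := by
  induction n with
  | zero => simp
  | succ n ih => rw [pow_succ', pow_succ', Equiv.Perm.mul_apply, ih, qperm_mk]; rfl

theorem qperm_mul (π ρ φ : Equiv.Perm D) (h : Commute φ π) (h' : Commute φ ρ) :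
    qperm π φ h * qperm ρ φ h' = qperm (π * ρ) φ (h.mul_right h') := by
  ext x
  induction x using Quotient.inductionOn with | _ x
  rfl

theorem qperm_sameCycle {π φ : Equiv.Perm D} (h : Commute φ π) {x y : D}
    (hxy : (qperm π φ h).SameCycle (Quotient.mk _ x) (Quotient.mk _ y)) :
    ∃ j < orderOf φ, π.SameCycle ((φ ^ j) x) y := by
  obtain ⟨n, -, hn⟩ := hxy.exists_pow_eq'
  rw [qperm_pow_mk, cyc_mk_eq] at hn
  obtain ⟨j, hj⟩ := hn.exists_nat_pow_eq
  refine ⟨j % orderOf φ, Nat.mod_lt _ (orderOf_pos φ), ?_⟩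
  rw [pow_mod_orderOf]
  refine ⟨n, ?_⟩
  rw [← hj, zpow_natCast, ← Equiv.Perm.mul_apply, ← Equiv.Perm.mul_apply,
    (h.pow_pow j n).eq]

def qproj (π φ : Equiv.Perm D) (h : Commute φ π) : CycQ π → CycQ (qperm π φ h) :=
  Quotient.map' (s₂ := Equiv.Perm.SameCycle.setoid (qperm π φ h)) (fun x => (Quotient.mk _ x : CycQ φ)) (by
    intro x y hxy
    obtain ⟨n, hn⟩ := Equiv.Perm.SameCycle.exists_nat_pow_eq hxy
    refine ⟨n, ?_⟩
    rw [zpow_natCast, qperm_pow_mk, hn])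

theorem qproj_mk (π φ : Equiv.Perm D) (h : Commute φ π) (x : D) :
    qproj π φ h (Quotient.mk _ x) = Quotient.mk _ (Quotient.mk _ x) := rfl

theorem fiber_le (π φ : Equiv.Perm D) (h : Commute φ π) (c : CycQ (qperm π φ h)) :
    (Finset.univ.filter fun z => qproj π φ h z = c).card ≤ orderOf φ := by
  induction c using Quotient.inductionOn with | _ c
  induction c using Quotient.inductionOn with | _ x
  have : (Finset.univ.filter fun z => qproj π φ h z = Quotient.mk _ (Quotient.mk _ x)) ⊆
      (Finset.range (orderOf φ)).image (fun j => (Quotient.mk _ ((φ ^ j) x) : CycQ π)) := by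
    intro z hz
    induction z using Quotient.inductionOn with | _ y
    rw [Finset.mem_filter, qproj_mk, cyc_mk_eq] at hz
    obtain ⟨j, hj, hjy⟩ := qperm_sameCycle h hz.2.symm
    rw [Finset.mem_image]
    exact ⟨j, Finset.mem_range.2 hj, cyc_mk_eq.2 hjy⟩
  exact (Finset.card_le_card this).trans (Finset.card_image_le.trans (by simp))

theorem pow_sameCycle_of_fix {π φ : Equiv.Perm D} (h : Commute φ π) {x : D}
    (hx : π.SameCycle x (φ x)) (j : ℕ) : π.SameCycle x ((φ ^ j) x) := by
  induction j with
  | zero => exact Equiv.Perm.SameCycle.refl _ _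
  | succ n ih =>
    rw [pow_succ', Equiv.Perm.mul_apply]
    exact hx.trans ((comm_sameCycle h.symm _ _).1 ih)

theorem fiber_fix (π φ : Equiv.Perm D) (h : Commute φ π) (x : D)
    (hx : π.SameCycle x (φ x)) :
    (Finset.univ.filter fun z => qproj π φ h z = Quotient.mk _ (Quotient.mk _ x)).card ≤ 1 := by
  have : (Finset.univ.filter fun z => qproj π φ h z = Quotient.mk _ (Quotient.mk _ x)) ⊆
      {(Quotient.mk _ x : CycQ π)} := by
    intro z hz
    induction z using Quotient.inductionOn with | _ y
    rw [Finset.mem_filter, qproj_mk, cyc_mk_eq] at hz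
    obtain ⟨j, hj, hjy⟩ := qperm_sameCycle h hz.2.symm
    rw [Finset.mem_singleton, cyc_mk_eq]
    exact ((pow_sameCycle_of_fix h hx j).trans hjy).symm
  exact (Finset.card_le_card this).trans (by simp)

theorem cyc_card_le (π φ : Equiv.Perm D) (h : Commute φ π) :
    Nat.card (CycQ π) ≤ orderOf φ * Nat.card (CycQ (qperm π φ h)) := by
  rw [Nat.card_eq_fintype_card, Nat.card_eq_fintype_card]
  have := Finset.card_le_mul_card_image_of_maps_to (s := (Finset.univ : Finset (CycQ π)))
    (t := Finset.univ) (f := qproj π φ h) (fun _ _ => Finset.mem_univ _) (orderOf φ)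
    (fun c _ => fiber_le π φ h c)
  simpa using this

theorem cyc_card_le_fix (π φ : Equiv.Perm D) (h : Commute φ π) (d : Fin 3 → D)
    (hd : ∀ i, π.SameCycle (d i) (φ (d i))) (hne : ∀ i j, π.SameCycle (d i) (d j) → i = j) :
    Nat.card (CycQ π) + 3 * (orderOf φ - 1) ≤ orderOf φ * Nat.card (CycQ (qperm π φ h)) := by
  rw [Nat.card_eq_fintype_card, Nat.card_eq_fintype_card]
  have h1 := Finset.card_eq_sum_card_fiberwise (s := (Finset.univ : Finset (CycQ π)))
    (t := Finset.univ) (f := qproj π φ h) (fun _ _ => Finset.mem_univ _)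
  let g : Fin 3 → CycQ (qperm π φ h) := fun i => Quotient.mk _ (Quotient.mk _ (d i))
  have hg : Function.Injective g := by
    intro i j hij
    simp only [g] at hij
    rw [cyc_mk_eq] at hij
    obtain ⟨k, _, hk⟩ := qperm_sameCycle h hij
    exact hne i j ((pow_sameCycle_of_fix h (hd i) k).trans hk)
  let T := Finset.univ.image g
  have hT : T.card = 3 := by
    rw [Finset.card_image_of_injective _ hg]; simp
  have h2 : ∀ c : CycQ (qperm π φ h),
      (Finset.univ.filter fun z => qproj π φ h z = c).card +
        (if c ∈ T then orderOf φ - 1 else 0) ≤ orderOf φ := by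
    intro c
    split_ifs with hc
    · obtain ⟨i, -, rfl⟩ := Finset.mem_image.1 hc
      have := fiber_fix π φ h (d i) (hd i)
      have := orderOf_pos φ
      simp only [g]
      omega
    · simpa using fiber_le π φ h c
  have h3 := Finset.sum_le_sum (s := Finset.univ) (fun c _ => h2 c)
  rw [Finset.sum_add_distrib, ← h1] at h3
  simp only [Finset.sum_ite_mem, Finset.univ_inter, Finset.sum_const, hT, smul_eq_mul,
    Finset.card_univ] at h3
  rw [mul_comm (orderOf φ)]
  exact h3

theorem free_card_le (s a φ : Equiv.Perm D) (hT : TransPair s a) (hs : Commute φ s)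
    (ha : Commute φ a) : orderOf φ * Nat.card (CycQ φ) ≤ Nat.card D := by
  have key : ∀ (k : ℕ) (d : D), (φ ^ k) d = d → φ ^ k = 1 := by
    intro k d hd
    ext e
    refine hT (fun x => (φ ^ k) x = x) (fun x => ?_) (fun x => ?_) d e hd
    · rw [← Equiv.Perm.mul_apply, (hs.pow_left k).eq, Equiv.Perm.mul_apply]; simp
    · rw [← Equiv.Perm.mul_apply, (ha.pow_left k).eq, Equiv.Perm.mul_apply]; simp
  have : Function.Injective
      (fun z : Fin (orderOf φ) × CycQ φ => (φ ^ (z.1 : ℕ)) (Quotient.out z.2)) := by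
    rintro ⟨i, c⟩ ⟨j, c'⟩ hij
    simp only at hij
    have hc : c = c' := by
      rw [← Quotient.out_eq c, ← Quotient.out_eq c', cyc_mk_eq]
      have h1 : φ.SameCycle (Quotient.out c) ((φ ^ (i : ℕ)) (Quotient.out c)) :=
        ⟨(i : ℕ), by simp⟩
      have h2 : φ.SameCycle (Quotient.out c') ((φ ^ (j : ℕ)) (Quotient.out c')) :=
        ⟨(j : ℕ), by simp⟩
      rw [hij] at h1
      exact h1.trans h2.symm
    subst hc
    have main : ∀ i j : ℕ, i ≤ j → j < orderOf φ →
        (φ ^ i) (Quotient.out c) = (φ ^ j) (Quotient.out c) → i = j := by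
      intro i j hle hj h
      obtain ⟨k, rfl⟩ := Nat.exists_eq_add_of_le hle
      rw [pow_add, Equiv.Perm.mul_apply] at h
      have h := (φ ^ i).injective h
      have h := key k _ h.symm
      have := orderOf_dvd_of_pow_eq_one h
      have : k = 0 := Nat.eq_zero_of_dvd_of_lt this (by omega)
      omega
    have : (i : ℕ) = j := by
      rcases le_total (i : ℕ) j with hle | hle
      · exact main _ _ hle j.2 hij
      · exact (main _ _ hle i.2 hij.symm).symm
    rw [Fin.ext this]
  have := Nat.card_le_card_of_injective _ this
  simpa [Nat.card_prod] using this

theorem rigid (s a φ : Equiv.Perm D) (hT : TransPair s a)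
    (hE : Nat.card (CycQ s) + Nat.card (CycQ a) + Nat.card (CycQ (s * a)) = Nat.card D + 2)
    (hs : Commute φ s) (ha : Commute φ a) (d : Fin 3 → D)
    (hd : ∀ i, s.SameCycle (d i) (φ (d i))) (hne : ∀ i j, s.SameCycle (d i) (d j) → i = j) :
    φ = 1 := by
  have hT' : TransPair (qperm s φ hs) (qperm a φ ha) := by
    intro P h1 h2 x y
    induction x using Quotient.inductionOn with | _ x
    induction y using Quotient.inductionOn with | _ y
    exact hT (fun x => P (Quotient.mk _ x)) (fun x => h1 (Quotient.mk _ x))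
      (fun x => h2 (Quotient.mk _ x)) x y
  have h1 := cyc_count _ _ hT'
  rw [qperm_mul] at h1
  have h2 := cyc_card_le_fix s φ hs d hd hne
  have h3 := cyc_card_le a φ ha
  have h4 := cyc_card_le (s * a) φ (hs.mul_right ha)
  have h5 := free_card_le s a φ hT hs ha
  have h6 := Nat.mul_le_mul_left (orderOf φ) h1
  have h7 := orderOf_pos φ
  rw [← orderOf_eq_one_iff]
  simp only [mul_add] at h6
  omega

end rigid
section graph
open Classical

theorem preconn_const {W : Type*} {G : SimpleGraph W} (h : G.Preconnected) (H : W → Prop)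
    (hH : ∀ x y, G.Adj x y → (H x ↔ H y)) (x y : W) : H x ↔ H y := by
  obtain ⟨p⟩ := h x y
  induction p with
  | nil => rfl
  | cons hadj _ ih => exact (hH _ _ hadj).trans ih

theorem cyc_const {D : Type*} [Finite D] (π : Equiv.Perm D) (P u : D → Prop)
    (h1 : ∀ x, P x → P (π x) → (u x ↔ u (π x)))
    (h2 : ∀ x x', π.SameCycle x x' → ¬ P x → P (π x) → ¬ P x' → P (π x') → x = x')
    {x y : D} (hxy : π.SameCycle x y) (hx : P x) (hy : P y) : u x ↔ u y := by
  by_cases hex : ∃ w, π.SameCycle x w ∧ ¬ P w ∧ P (π w)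
  · obtain ⟨w, hxw, hw, hpw⟩ := hex
    have key : ∀ n : ℕ, P ((π ^ n) (π w)) → (u ((π ^ n) (π w)) ↔ u (π w)) := by
      intro n
      induction n with
      | zero => simp
      | succ n ih =>
        intro hP
        rw [pow_succ', Equiv.Perm.mul_apply] at hP ⊢
        by_cases hq : P ((π ^ n) (π w))
        · rw [← h1 _ hq hP]; exact ih hq
        · have : w = (π ^ n) (π w) := by
            refine h2 _ _ ?_ hw hpw hq hP
            refine ⟨n + 1, ?_⟩
            rw [← Nat.cast_succ, zpow_natCast, pow_succ, Equiv.Perm.mul_apply]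
          rw [← this]
    have hz : ∀ z, π.SameCycle x z → P z → (u z ↔ u (π w)) := by
      intro z hz hPz
      have : π.SameCycle (π w) z := by
        rw [Equiv.Perm.sameCycle_apply_left]; exact hxw.symm.trans hz
      obtain ⟨n, rfl⟩ := this.exists_nat_pow_eq
      exact key n hPz
    exact (hz x (Equiv.Perm.SameCycle.refl _ _) hx).trans (hz y hxy hy).symm
  · push Not at hex
    have key : ∀ n : ℕ, ∀ y, π.SameCycle x y → P ((π ^ n) y) → P y ∧ (u y ↔ u ((π ^ n) y)) := by
      intro n
      induction n with
      | zero => intro y _ hy; simpa using hy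
      | succ n ih =>
        intro y hy hP
        rw [pow_succ, Equiv.Perm.mul_apply] at hP ⊢
        have h := ih (π y) (by rw [Equiv.Perm.sameCycle_apply_right]; exact hy) hP
        have hPy : P y := by
          by_contra hc
          exact hex y hy hc h.1
        exact ⟨hPy, (h1 y hPy h.1).trans h.2⟩
    obtain ⟨n, hn⟩ := hxy.symm.exists_nat_pow_eq
    have := (key n y hxy (by rw [hn]; exact hx)).2
    rw [hn] at this
    exact this.symm

theorem sameCycle_const {D β : Type*} [Finite D] {π : Equiv.Perm D} {u : D → β}
    (hu : ∀ d, u (π d) = u d) {x y : D} (h : π.SameCycle x y) : u x = u y := by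
  obtain ⟨n, rfl⟩ := h.exists_nat_pow_eq
  clear h
  induction n with
  | zero => rfl
  | succ n ih => rw [pow_succ', Equiv.Perm.mul_apply, hu]; exact ih

variable {V : Type*} [Fintype V] {G : SimpleGraph V}

@[simp] theorem dartRev_fst (d : G.Dart) : (dartRev G d).fst = d.snd := rfl
@[simp] theorem dartRev_snd (d : G.Dart) : (dartRev G d).snd = d.fst := rfl
@[simp] theorem dartRev_rev (d : G.Dart) : dartRev G (dartRev G d) = d := Dart.symm_symm d

theorem dart_eq {d e : G.Dart} (h1 : d.fst = e.fst) (h2 : d.snd = e.snd) : d = e :=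
  Dart.ext (h := Prod.ext h1 h2)

/-- Facts on a rotation system used in the proof. -/
structure PData (G : SimpleGraph V) (σ : Equiv.Perm G.Dart) : Prop where
  tail : ∀ d : G.Dart, (σ d).fst = d.fst
  rot : ∀ d e : G.Dart, d.fst = e.fst → σ.SameCycle d e
  eul : Nat.card (CycQ σ) + Nat.card (CycQ (dartRev G)) + Nat.card (CycQ (σ * dartRev G))
    = Nat.card G.Dart + 2
  conn : ∀ H : V → Prop, (∀ x y, G.Adj x y → (H x ↔ H y)) → ∀ x y, H x ↔ H y
  conn3 : ∀ (v w : V) (H : V → Prop), (∀ x y, x ≠ v → x ≠ w → y ≠ v → y ≠ w → G.Adj x y →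
    (H x ↔ H y)) → ∀ x y, x ≠ v → x ≠ w → y ≠ v → y ≠ w → (H x ↔ H y)
  deg : ∀ d : G.Dart, σ (σ d) ≠ d
  out : ∀ v : V, ∃ d : G.Dart, d.fst = v

namespace PData

variable {σ : Equiv.Perm G.Dart}

theorem sc_iff (hP : PData G σ) (d e : G.Dart) : σ.SameCycle d e ↔ d.fst = e.fst := by
  refine ⟨fun h => ?_, hP.rot d e⟩
  obtain ⟨n, rfl⟩ := h.exists_nat_pow_eq
  induction n with
  | zero => rfl
  | succ n ih => rw [pow_succ', Equiv.Perm.mul_apply, hP.tail]; exact ih ⟨n, by simp⟩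

theorem tail_symm (hP : PData G σ) (d : G.Dart) : (σ.symm d).fst = d.fst := by
  rw [← hP.tail (σ.symm d)]; simp

theorem deg1 (hP : PData G σ) (d : G.Dart) : σ d ≠ d := fun h => hP.deg d (by rw [h, h])

theorem trans (hP : PData G σ) : TransPair σ (dartRev G) := by
  intro P h1 h2 d e
  have hv : ∀ x y : G.Dart, x.fst = y.fst → (P x ↔ P y) := by
    intro x y hxy
    exact cyc_const σ (fun _ => True) P (fun x _ _ => (h1 x).symm) (by simp) (hP.rot x y hxy)
      trivial trivial
  have := hP.conn (fun v => ∃ x : G.Dart, x.fst = v ∧ P x) (by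
    intro x y hxy
    let m : G.Dart := ⟨(x, y), hxy⟩
    constructor
    · rintro ⟨z, hz, hPz⟩
      refine ⟨dartRev G m, rfl, ?_⟩
      rw [h2, hv m z hz.symm]; exact hPz
    · rintro ⟨z, hz, hPz⟩
      refine ⟨m, rfl, ?_⟩
      rw [← h2, hv (dartRev G m) z hz.symm]; exact hPz) d.fst e.fst
  intro hd
  obtain ⟨x, hx, hPx⟩ := this.1 ⟨d, rfl, hd⟩
  exact (hv x e hx).1 hPx

theorem conn3D (hP : PData G σ) (v w : V) (t : G.Dart → ZMod 2) (h1 : ∀ m, t (dartRev G m) = t m)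
    (h2 : ∀ m : G.Dart, m.fst ≠ v → m.fst ≠ w → t (σ m) = t m) (m n : G.Dart)
    (hm : (m.fst ≠ v ∧ m.fst ≠ w) ∨ (m.snd ≠ v ∧ m.snd ≠ w))
    (hn : (n.fst ≠ v ∧ n.fst ≠ w) ∨ (n.snd ≠ v ∧ n.snd ≠ w)) : t m = t n := by
  wlog hm' : m.fst ≠ v ∧ m.fst ≠ w generalizing m
  · rw [← h1]
    exact this (dartRev G m) hm.symm (by simpa using hm.resolve_left hm')
  wlog hn' : n.fst ≠ v ∧ n.fst ≠ w generalizing n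
  · rw [← h1 n]
    exact this (dartRev G n) hn.symm (by simpa using hn.resolve_left hn')
  have hv : ∀ x y : G.Dart, x.fst ≠ v → x.fst ≠ w → x.fst = y.fst → t x = t y := by
    intro x y hxv hxw hxy
    have := cyc_const σ (fun z => z.fst = x.fst) (fun z => t z = t x)
      (fun z hz _ => by rw [h2 z (hz ▸ hxv) (hz ▸ hxw)])
      (fun z z' _ hz hz' _ _ => by rw [hP.tail] at hz'; exact absurd hz' hz)
      (hP.rot x y hxy) rfl hxy.symm
    exact (this.1 rfl).symm
  have := hP.conn3 v w (fun z => ∃ x : G.Dart, x.fst = z ∧ t x = t m) (by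
    intro x y hxv hxw hyv hyw hxy
    let e : G.Dart := ⟨(x, y), hxy⟩
    constructor
    · rintro ⟨z, rfl, hPz⟩
      exact ⟨dartRev G e, rfl, by rw [h1, ← hv z e hxv hxw rfl]; exact hPz⟩
    · rintro ⟨z, rfl, hPz⟩
      exact ⟨e, rfl, by rw [← h1, ← hv z (dartRev G e) hyv hyw rfl]; exact hPz⟩)
      m.fst n.fst hm'.1 hm'.2 hn'.1 hn'.2
  obtain ⟨z, hz, hzt⟩ := this.1 ⟨m, rfl, rfl⟩
  rw [← hzt]
  exact hv z n (hz ▸ hn'.1) (hz ▸ hn'.2) hz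

theorem sum_single_s (d : G.Dart) (u : G.Dart → ZMod 2) (hu : ∀ d, u (σ d) = u d) :
    ∑ x, u x * (Pi.single (σ.symm d) 1 : G.Dart → ZMod 2) x = u d := by
  have : u d = u (σ.symm d) := by rw [← hu (σ.symm d)]; simp
  rw [this]
  simp [Pi.single_apply]

theorem sum_single_f (d : G.Dart) (u : G.Dart → ZMod 2)
    (hu : ∀ d, u ((σ * dartRev G) d) = u d) :
    ∑ x, u x * (Pi.single (σ.symm d) 1 : G.Dart → ZMod 2) (dartRev G x) = u d := by
  have : u d = u (dartRev G (σ.symm d)) := by rw [← hu (dartRev G (σ.symm d))]; simp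
  rw [this]
  rw [← Equiv.sum_comp (dartRev G)]
  simp [Pi.single_apply]

/-- A face visits each vertex at most once. -/
theorem P1 (hP : PData G σ) {d e : G.Dart} (hf : (σ * dartRev G).SameCycle d e) (ht : d.fst = e.fst) : d = e := by
  by_contra hne
  obtain ⟨t, h1, h2⟩ := cyc_cohom σ (dartRev G) hP.trans hP.eul
    (Pi.single (σ.symm d) 1 + Pi.single (σ.symm e) 1) 0
    (by
      intro u hu
      simp only [Pi.add_apply, mul_add, Finset.sum_add_distrib, sum_single_s _ u hu]
      rw [sameCycle_const hu (hP.rot d e ht)]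
      exact CharTwo.add_self_eq_zero _)
    (by simp)
    (by
      intro u hu
      simp only [Pi.add_apply, Pi.zero_apply, zero_add, mul_add, Finset.sum_add_distrib,
        sum_single_f _ u hu]
      rw [sameCycle_const hu hf]
      exact CharTwo.add_self_eq_zero _)
  have h3 := hP.conn3D d.fst d.fst t (by simpa using h2) (by
    intro m hm _
    rw [h1]
    have e1 : m ≠ σ.symm d := by rintro rfl; exact hm (hP.tail_symm d)
    have e2 : m ≠ σ.symm e := by rintro rfl; exact hm ((hP.tail_symm e).trans ht.symm)
    simp [e1, e2])
  have h4 := h1 (σ.symm d)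
  have h5 : t d = t (σ.symm d) := by
    apply h3
    · right; simp [d.adj.ne']
    · right; rw [← hP.tail_symm d]; simp [(σ.symm d).adj.ne']
  have e1 : σ.symm d ≠ σ.symm e := fun h => hne (σ.symm.injective h)
  simp [e1, h5] at h4

/-- Two distinct faces share at most a vertex or an edge. -/
theorem P2 (hP : PData G σ) {d e d' e' : G.Dart} (hf : (σ * dartRev G).SameCycle d e)
    (hf' : (σ * dartRev G).SameCycle d' e') (hd : d.fst = d'.fst) (he : e.fst = e'.fst)
    (hne : d.fst ≠ e.fst) (hdd : ¬ (σ * dartRev G).SameCycle d d') :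
    (σ * dartRev G) d = e ∨ (σ * dartRev G) e = d := by
  obtain ⟨t, h1, h2⟩ := cyc_cohom σ (dartRev G) hP.trans hP.eul
    ((Pi.single (σ.symm d) 1 + Pi.single (σ.symm e) 1) +
      (Pi.single (σ.symm d') 1 + Pi.single (σ.symm e') 1)) 0
    (by
      intro u hu
      simp only [Pi.add_apply, mul_add, Finset.sum_add_distrib, sum_single_s _ u hu]
      rw [sameCycle_const hu (hP.rot d d' hd), sameCycle_const hu (hP.rot e e' he)]
      exact CharTwo.add_self_eq_zero _)
    (by simp)
    (by
      intro u hu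
      simp only [Pi.add_apply, Pi.zero_apply, zero_add, mul_add, Finset.sum_add_distrib,
        sum_single_f _ u hu]
      rw [sameCycle_const hu hf, sameCycle_const hu hf']
      simp [CharTwo.add_self_eq_zero])
  have h3 := hP.conn3D d.fst e.fst t (by simpa using h2) (by
    intro m hm hm'
    rw [h1]
    have e1 : m ≠ σ.symm d := by rintro rfl; exact hm (hP.tail_symm d)
    have e2 : m ≠ σ.symm e := by rintro rfl; exact hm' (hP.tail_symm e)
    have e3 : m ≠ σ.symm d' := by rintro rfl; exact hm ((hP.tail_symm d').trans hd.symm)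
    have e4 : m ≠ σ.symm e' := by rintro rfl; exact hm' ((hP.tail_symm e').trans he.symm)
    simp [e1, e2, e3, e4])
  have h4 := h1 (σ.symm d)
  have e1 : σ.symm d ≠ σ.symm e := fun h => hne (by rw [σ.symm.injective h])
  have e2 : σ.symm d ≠ σ.symm d' := fun h => hdd (by
    rw [σ.symm.injective h])
  have e3 : σ.symm d ≠ σ.symm e' := fun h => hne (by rw [σ.symm.injective h, he])
  have h5 : t d ≠ t (σ.symm d) := by
    intro h5
    simp [e1, e2, e3, h5] at h4
  by_cases hs : d.snd = e.fst
  · left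
    apply hP.P1
    · exact (Equiv.Perm.sameCycle_apply_left.2 hf)
    · simp [hP.tail, hs]
  by_cases hs' : (σ.symm d).snd = e.fst
  · right
    have : e = dartRev G (σ.symm d) := by
      apply hP.P1
      · rw [← Equiv.Perm.sameCycle_apply_right]
        simpa using hf.symm
      · simp [hs']
    rw [this]; simp
  · exfalso
    apply h5
    apply h3
    · right; exact ⟨d.adj.ne', hs⟩
    · right; refine ⟨?_, hs'⟩
      rw [← hP.tail_symm d]; exact (σ.symm d).adj.ne'


theorem rev_not_mem (hP : PData G σ) {c x : G.Dart} (hx : (σ * dartRev G).SameCycle c x) :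
    ¬ (σ * dartRev G).SameCycle c (dartRev G x) := by
  intro h
  have h1 : (σ * dartRev G).SameCycle c ((σ * dartRev G) x) :=
    Equiv.Perm.sameCycle_apply_right.2 hx
  have h2 := hP.P1 (h1.symm.trans h) (by simp [hP.tail])
  exact hP.deg1 (dartRev G x) (by simpa using h2)

theorem rev_mem_iff {c x : G.Dart} :
    (σ * dartRev G).SameCycle c (dartRev G x) ↔ (σ * dartRev G).SameCycle c (σ x) := by
  rw [← Equiv.Perm.sameCycle_apply_right]; simp

/-- faces have no chords -/
theorem chord (hP : PData G σ) {c m d e : G.Dart} (hd : (σ * dartRev G).SameCycle c d)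
    (he : (σ * dartRev G).SameCycle c e) (hdm : d.fst = m.fst) (hem : e.fst = m.snd) :
    (σ * dartRev G).SameCycle c m ∨ (σ * dartRev G).SameCycle c (dartRev G m) := by
  by_contra hcon
  push Not at hcon
  have hm : (σ * dartRev G).SameCycle m ((σ * dartRev G) m) :=
    Equiv.Perm.sameCycle_apply_right.2 (Equiv.Perm.SameCycle.refl _ _)
  have := hP.P2 (hd.symm.trans he) hm hdm (by simp [hP.tail, hem])
    (by rw [hdm, hem]; exact m.adj.ne) (fun h => hcon.1 (hd.trans h))
  rcases this with h | h
  · apply hcon.1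
    have : d = m := by
      apply dart_eq hdm
      rw [← hem, ← h]; simp [hP.tail]
    rwa [← this]
  · apply hcon.2
    have : e = dartRev G m := by
      apply dart_eq (by simpa using hem)
      rw [dartRev_snd, ← hdm, ← h]; simp [hP.tail]
    rwa [← this]

/-- faces are non-separating -/
theorem nonsep (hP : PData G σ) (c : G.Dart) (H : V → Prop)
    (hH : ∀ x y, (∀ d : G.Dart, (σ * dartRev G).SameCycle c d → d.fst ≠ x) →
      (∀ d : G.Dart, (σ * dartRev G).SameCycle c d → d.fst ≠ y) → G.Adj x y → (H x ↔ H y))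
    (x y : V) (hx : ∀ d : G.Dart, (σ * dartRev G).SameCycle c d → d.fst ≠ x)
    (hy : ∀ d : G.Dart, (σ * dartRev G).SameCycle c d → d.fst ≠ y) : H x ↔ H y := by
  let f := σ * dartRev G
  let off : V → Prop := fun v => ∀ d : G.Dart, f.SameCycle c d → d.fst ≠ v
  have hf1 (d : G.Dart) : (f d).fst = d.snd := by simp [f, hP.tail]
  have L1 : ∀ d e : G.Dart, ¬ f.SameCycle c d → f.SameCycle d e → off d.fst → off e.fst →
      (H d.fst ↔ H e.fst) := by
    intro d e hcd hde hd he
    refine cyc_const f (fun z => ¬ f.SameCycle c z ∧ off z.fst) (fun z => H z.fst) ?_ ?_ hde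
      ⟨hcd, hd⟩ ⟨fun h => hcd (h.trans hde.symm), he⟩
    · intro z hz hz'
      refine hH _ _ hz.2 hz'.2 ?_
      rw [hf1]; exact z.adj
    · intro z z' hzz hz hz1 hz' hz1'
      by_contra hne
      have hz2 : ¬ f.SameCycle c z := fun h => hz1.1 (Equiv.Perm.sameCycle_apply_right.2 h)
      have hz2' : ¬ f.SameCycle c z' := fun h => hz1'.1 (Equiv.Perm.sameCycle_apply_right.2 h)
      have ha : ¬ off z.fst := fun h => hz ⟨hz2, h⟩
      have ha' : ¬ off z'.fst := fun h => hz' ⟨hz2', h⟩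
      simp only [off, not_forall, not_not] at ha ha'
      obtain ⟨w, hw, hwz⟩ := ha
      obtain ⟨w', hw', hwz'⟩ := ha'
      rcases hP.P2 hzz (hw.symm.trans hw') hwz.symm hwz'.symm
        (fun h => hne (hP.P1 hzz h)) (fun h => hz2 (hw.trans h.symm)) with h | h
      · exact hz1.2 w' hw' (by rw [hwz', ← h])
      · exact hz1'.2 w hw (by rw [hwz, ← h])
  let u : G.Dart → Prop := fun d => ∃ e : G.Dart, f.SameCycle d e ∧ off e.fst ∧ H e.fst
  have huf : ∀ d e, f.SameCycle d e → (u d ↔ u e) := by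
    intro d e h
    constructor
    · rintro ⟨z, hz, h'⟩; exact ⟨z, h.symm.trans hz, h'⟩
    · rintro ⟨z, hz, h'⟩; exact ⟨z, h.trans hz, h'⟩
  have hu : ∀ d e, ¬ f.SameCycle c d → f.SameCycle d e → off e.fst → (u d ↔ H e.fst) := by
    intro d e hcd hde he
    constructor
    · rintro ⟨z, hz, hoff, hHz⟩
      exact (L1 z e (fun h => hcd (h.trans hz.symm)) (hz.symm.trans hde) hoff he).1 hHz
    · intro h; exact ⟨e, hde, he, h⟩
  have fself (d : G.Dart) : f.SameCycle d (f d) :=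
    Equiv.Perm.sameCycle_apply_right.2 (Equiv.Perm.SameCycle.refl _ _)
  have hur : ∀ d, ¬ f.SameCycle c d → ¬ f.SameCycle c (dartRev G d) →
      (u d ↔ u (dartRev G d)) := by
    intro d h1 h2
    by_cases ho : off d.fst
    · rw [hu d d h1 (Equiv.Perm.SameCycle.refl _ _) ho,
        hu (dartRev G d) (f (dartRev G d)) h2 (fself _) (by simpa [hf1] using ho), hf1]
      simp
    · by_cases ho' : off d.snd
      · rw [hu (dartRev G d) _ h2 (Equiv.Perm.SameCycle.refl _ _) ho',
          hu d (f d) h1 (fself _) (by simpa [hf1] using ho'), hf1]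
        simp
      · exfalso
        simp only [off, not_forall, not_not] at ho ho'
        obtain ⟨w, hw, hwz⟩ := ho
        obtain ⟨w', hw', hwz'⟩ := ho'
        rcases hP.chord hw hw' hwz hwz' with h | h
        · exact h1 h
        · exact h2 h
  have L2 : ∀ d e : G.Dart, d.fst = e.fst → ¬ f.SameCycle c d → ¬ f.SameCycle c e →
      (u d ↔ u e) := by
    intro d e hde hd he
    refine cyc_const σ (fun z => ¬ f.SameCycle c z) u ?_ ?_ (hP.rot d e hde) hd he
    · intro z hz hz'
      have e1 : f (dartRev G z) = σ z := by simp [f]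
      rw [hur z hz (fun h => hz' (by rw [← e1]; exact Equiv.Perm.sameCycle_apply_right.2 h))]
      apply huf
      rw [← e1]; exact fself _
    · intro z z' hzz hz _ hz' _
      rw [not_not] at hz hz'
      exact hP.P1 (hz.symm.trans hz') ((hP.sc_iff _ _).1 hzz)
  let U : V → Prop := fun v => ∃ d : G.Dart, d.fst = v ∧ ¬ f.SameCycle c d ∧ u d
  have hU : ∀ d, ¬ f.SameCycle c d → (U d.fst ↔ u d) := by
    intro d hd
    constructor
    · rintro ⟨z, hz, hz', huz⟩
      exact (L2 z d hz hz' hd).1 huz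
    · intro h; exact ⟨d, rfl, hd, h⟩
  have hUa : ∀ d, ¬ f.SameCycle c d → (U d.fst ↔ U d.snd) := by
    intro d hd
    have hd' : ¬ f.SameCycle c (f d) := fun h => hd (Equiv.Perm.sameCycle_apply_right.1 h)
    rw [hU d hd, ← hf1, hU (f d) hd']
    exact huf _ _ (fself d)
  have hUc := hP.conn U (by
    intro x y hxy
    let d : G.Dart := ⟨(x, y), hxy⟩
    by_cases hd : f.SameCycle c d
    · exact (hUa (dartRev G d) (hP.rev_not_mem hd)).symm
    · exact hUa d hd) x y
  have hUo : ∀ v, off v → (U v ↔ H v) := by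
    intro v hv
    obtain ⟨d, rfl⟩ := hP.out v
    have hd : ¬ f.SameCycle c d := fun h => hv d h rfl
    rw [hU d hd, hu d d hd (Equiv.Perm.SameCycle.refl _ _) hv]
  rw [← hUo x hx, ← hUo y hy]
  exact hUc

theorem whitney_face (hP : PData G σ) {τ : Equiv.Perm G.Dart} (hQ : PData G τ) (c : G.Dart) :
    (∀ n, (τ * dartRev G).SameCycle c n → σ (dartRev G n) = τ (dartRev G n)) ∨
    (∀ n, (τ * dartRev G).SameCycle c n → σ (τ (dartRev G n)) = dartRev G n) := by
  let C : G.Dart → Prop := fun x => (τ * dartRev G).SameCycle c x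
  let i : G.Dart → ZMod 2 := fun x => if C x then 1 else 0
  let cc : G.Dart → ZMod 2 := fun x => i x + i (dartRev G x)
  have hir : ∀ x, i (dartRev G x) = i (τ x) := by
    intro x
    simp only [i, C, rev_mem_iff]
  obtain ⟨s, hs1, hs2⟩ := cyc_cohom σ (dartRev G) hP.trans hP.eul cc cc
    (by
      intro u hu
      have h1 : ∀ x, u (τ x) = u x := fun x =>
        sameCycle_const hu (hP.rot _ _ (hQ.tail x))
      simp only [cc, mul_add, Finset.sum_add_distrib, hir]
      have : ∑ x, u x * i (τ x) = ∑ x, u x * i x := by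
        rw [← Equiv.sum_comp τ (fun x => u x * i x)]
        simp only [h1]
      rw [this]
      exact CharTwo.add_self_eq_zero _)
    (by
      intro u hu
      simp only [cc, mul_add, Finset.sum_add_distrib]
      have : ∑ x, u x * i (dartRev G x) = ∑ x, u x * i x := by
        rw [← Equiv.sum_comp (dartRev G) (fun x => u x * i x)]
        simp only [hu]
      rw [this]
      exact CharTwo.add_self_eq_zero _)
    (by
      intro u hu
      have : ∀ x, cc x + cc (dartRev G x) = 0 := by
        intro x
        simp only [cc, dartRev_rev]
        rw [add_comm (i (dartRev G x)) (i x)]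
        exact CharTwo.add_self_eq_zero _
      simp [this])
  have ccr (x) : cc (dartRev G x) = cc x := by simp only [cc, dartRev_rev]; exact add_comm _ _
  have cc0 : ∀ x, ¬ C x → ¬ C (dartRev G x) → cc x = 0 := by
    intro x h1 h2; simp [cc, i, h1, h2]
  have cc1 : ∀ x, C x → cc x = 1 := by
    intro x h1
    have h2 : ¬ C (dartRev G x) := hQ.rev_not_mem h1
    simp [cc, i, h1, h2]
  have hsf : ∀ y, s (σ (dartRev G y)) = s y := by
    intro y
    rw [hs1, hs2, ccr, add_assoc, CharTwo.add_self_eq_zero, add_zero]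
  let off : V → Prop := fun v => ∀ d : G.Dart, C d → d.fst ≠ v
  have offcc : ∀ x : G.Dart, off x.fst → cc x = 0 := by
    intro x hx
    refine cc0 x (fun h => hx x h rfl) (fun h => ?_)
    refine hx _ (Equiv.Perm.sameCycle_apply_right.2 h) ?_
    simp [hQ.tail]
  have hoff : ∀ x, ¬ C x → ¬ C (dartRev G x) → off x.fst ∨ off x.snd := by
    intro x h1 h2
    by_contra hcon
    simp only [not_or, off, not_forall, not_not] at hcon
    obtain ⟨⟨w, hw, hwz⟩, w', hw', hwz'⟩ := hcon
    rcases hQ.chord hw hw' hwz hwz' with h | h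
    · exact h1 h
    · exact h2 h
  -- a dart outside
  have hcC : C c := Equiv.Perm.SameCycle.refl _ _
  obtain ⟨x0, hx0⟩ : ∃ x0 : G.Dart, off x0.fst := by
    have h1 : ¬ C (τ c) := fun h => hQ.deg1 c (hQ.P1 (hcC.symm.trans h) (hQ.tail c).symm).symm
    have h2 : ¬ C (dartRev G (τ c)) := by
      intro h
      have h := rev_mem_iff.1 h
      exact hQ.deg c (hQ.P1 (hcC.symm.trans h) (by rw [hQ.tail, hQ.tail])).symm
    rcases hoff _ h1 h2 with h | h
    · exact ⟨_, h⟩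
    · exact ⟨dartRev G (τ c), h⟩
  let k0 := s x0
  have hv : ∀ x y : G.Dart, off x.fst → x.fst = y.fst → s x = s y := by
    intro x y hx hxy
    have := cyc_const σ (fun z => z.fst = x.fst) (fun z => s z = s x)
      (fun z hz _ => by rw [hs1, offcc z (by rw [hz]; exact hx), add_zero])
      (fun z z' _ hz hz' _ _ => by rw [hP.tail] at hz'; exact absurd hz' hz)
      (hP.rot x y hxy) rfl hxy.symm
    exact (this.1 rfl).symm
  have hk1 : ∀ x : G.Dart, off x.fst → s x = k0 := by
    intro x hx
    have := hQ.nonsep c (fun v => ∃ d : G.Dart, d.fst = v ∧ s d = k0) (by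
      intro v w hv1 hw1 hvw
      let e : G.Dart := ⟨(v, w), hvw⟩
      have he : s (dartRev G e) = s e := by rw [hs2, offcc e hv1, add_zero]
      constructor
      · rintro ⟨z, hz, hz'⟩
        refine ⟨dartRev G e, rfl, ?_⟩
        rw [he, ← hz']
        exact hv e z hv1 hz.symm
      · rintro ⟨z, hz, hz'⟩
        refine ⟨e, rfl, ?_⟩
        rw [← he, ← hz']
        exact hv (dartRev G e) z hw1 hz.symm) x0.fst x.fst hx0 hx
    obtain ⟨z, hz, hz'⟩ := this.1 ⟨x0, rfl, rfl⟩
    rw [← hz']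
    exact hv x z hx hz.symm
  have hk : ∀ y, s y ≠ k0 → C y ∨ C (dartRev G y) := by
    intro y hy
    by_contra hcon
    push Not at hcon
    apply hy
    rcases hoff y hcon.1 hcon.2 with h | h
    · exact hk1 y h
    · rw [← hk1 (dartRev G y) h, hs2, cc0 y hcon.1 hcon.2, add_zero]
  have z2 : ∀ a b : ZMod 2, a + 1 ≠ b ↔ a = b := by decide
  have hedge : ∀ n y, C n → y.fst = n.snd → (C y ∨ C (dartRev G y)) →
      y = τ (dartRev G n) ∨ y = dartRev G n := by
    intro n y hn hy h
    have hm : C (τ (dartRev G n)) := rev_mem_iff.1 (by simpa using hn)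
    rcases h with h | h
    · left
      exact hQ.P1 (h.symm.trans hm) (by simp [hQ.tail, hy])
    · right
      have h := rev_mem_iff.1 h
      exact τ.injective (hQ.P1 (h.symm.trans hm) (by simp [hQ.tail, hy]))
  have case1 : ∀ n, C n → s (τ (dartRev G n)) ≠ k0 → σ (dartRev G n) = τ (dartRev G n) := by
    intro n hn h
    set m := τ (dartRev G n) with hm
    have h1 : s (dartRev G (σ.symm m)) ≠ k0 := by
      rw [← hsf]; simpa using h
    have h2 := (hk _ h1).symm
    rw [dartRev_rev] at h2
    rcases hedge n _ hn (by rw [hP.tail_symm, hm, hQ.tail]; rfl) h2 with h3 | h3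
    · exfalso
      rw [← hm] at h3
      exact hP.deg1 m ((Equiv.symm_apply_eq σ).1 h3).symm
    · rw [← h3]; simp
  have case2 : ∀ n, C n → s (τ (dartRev G n)) = k0 →
      σ (τ (dartRev G n)) = dartRev G n ∧ s n = k0 := by
    intro n hn h
    set m := τ (dartRev G n) with hm
    have hmC : C m := rev_mem_iff.1 (by simpa using hn)
    have h1 : s (dartRev G m) = k0 + 1 := by rw [hs2, cc1 m hmC, h]
    have h2 : s (σ m) = k0 + 1 := by
      rw [← h1, ← hsf (dartRev G m), dartRev_rev]
    have h3 : s (σ m) ≠ k0 := by rw [h2, z2]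
    rcases hedge n _ hn (by rw [hP.tail, hm, hQ.tail]; rfl) (hk _ h3) with h4 | h4
    · exact absurd h4 (hP.deg1 m)
    · refine ⟨h4, ?_⟩
      have : s (dartRev G n) = s n + 1 := by rw [hs2, cc1 n hn]
      rw [← h4, h2] at this
      exact (add_right_cancel this).symm
  have hiff : ∀ n, C n → (s n = k0 ↔ s (τ (dartRev G n)) = k0) := by
    intro n hn
    refine ⟨fun h => ?_, fun h => (case2 n hn h).2⟩
    by_contra hne
    have h1 := case1 n hn hne
    rw [← h1, hsf] at hne
    exact hne h
  have hall : ∀ n, C n → (s c = k0 ↔ s n = k0) := by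
    intro n hn
    refine cyc_const (τ * dartRev G) C (fun z => s z = k0) (fun x hx _ => hiff x hx) ?_ hn hcC hn
    intro x x' _ hx hx' _ _
    exact absurd (Equiv.Perm.sameCycle_apply_right.1 hx') hx
  by_cases h : s c = k0
  · right
    intro n hn
    exact (case2 n hn ((hiff n hn).1 ((hall n hn).1 h))).1
  · left
    intro n hn
    exact case1 n hn (fun h' => h ((hall n hn).2 ((hiff n hn).2 h')))

theorem whitney (hP : PData G σ) {τ : Equiv.Perm G.Dart} (hQ : PData G τ) : τ = σ ∨ τ = σ⁻¹ := by
  have W : ∀ y, τ y = σ y ∨ σ (τ y) = y := by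
    intro y
    rcases hP.whitney_face hQ (dartRev G y) with h | h
    · left; simpa using (h _ (Equiv.Perm.SameCycle.refl _ _)).symm
    · right; simpa using h _ (Equiv.Perm.SameCycle.refl _ _)
  let u : G.Dart → Prop := fun x => τ x = σ x
  have h1 : ∀ x, u (τ x) ↔ u x := by
    intro x
    constructor
    · intro h
      rcases W x with h' | h'
      · exact h'
      · exact absurd (h.trans h') (hQ.deg x)
    · intro h
      rcases W (τ x) with h' | h'
      · exact h'
      · have h : τ x = σ x := h
        have h2 : σ (τ (τ x)) = σ x := h'.trans h
        exact absurd (σ.injective h2) (hQ.deg x)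
  have h2 : ∀ x, u (dartRev G (τ x)) ↔ u x := by
    intro x
    have e : (τ * dartRev G).SameCycle (dartRev G x) (τ x) :=
      rev_mem_iff.1 (Equiv.Perm.SameCycle.refl _ _)
    have no : ∀ y, σ (τ y) = y → ¬ u y := by
      intro y hy h
      have h : τ y = σ y := h
      rw [h] at hy
      exact hP.deg y hy
    rcases hP.whitney_face hQ (dartRev G x) with h | h
    · have ha := h _ (Equiv.Perm.SameCycle.refl _ _)
      have hb := h _ e
      rw [dartRev_rev] at ha
      exact ⟨fun _ => ha.symm, fun _ => hb.symm⟩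
    · have ha := h _ (Equiv.Perm.SameCycle.refl _ _)
      have hb := h _ e
      rw [dartRev_rev] at ha
      exact ⟨fun h => absurd h (no _ hb), fun h => absurd h (no _ ha)⟩
  have h3 : ∀ x, u (dartRev G x) ↔ u x := by
    intro x
    have := h2 (τ.symm x)
    rw [Equiv.apply_symm_apply] at this
    rw [this, ← h1]; simp
  by_cases hex : ∃ x, u x
  · left
    obtain ⟨x, hx⟩ := hex
    ext1 y
    exact hQ.trans u h1 h3 x y hx
  · right
    push Not at hex
    rw [eq_inv_iff_mul_eq_one]
    have : ∀ y, σ (τ y) = y := fun y => (W y).resolve_left (hex y)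
    have : σ * τ = 1 := by ext1 y; exact this y
    exact mul_eq_one_comm.1 this

end PData
end graph

section final
open Classical

variable {V : Type*} [Fintype V] {G : SimpleGraph V}

theorem card_cyc {D β : Type*} (π : Equiv.Perm D) (f : D → β)
    (hf : ∀ d e, π.SameCycle d e ↔ f d = f e) (hs : Function.Surjective f) :
    Nat.card (CycQ π) = Nat.card β := by
  refine Nat.card_eq_of_bijective
    (Quotient.lift f (fun a b h => (hf a b).1 h) : CycQ π → β) ⟨?_, ?_⟩
  · intro x y
    induction x using Quotient.inductionOn with | _ x
    induction y using Quotient.inductionOn with | _ y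
    intro h
    exact Quotient.sound ((hf x y).2 h)
  · intro b
    obtain ⟨d, hd⟩ := hs b
    exact ⟨Quotient.mk _ d, hd⟩

theorem card_cyc_conj {D : Type*} (π g : Equiv.Perm D) :
    Nat.card (CycQ (g * π * g⁻¹)) = Nat.card (CycQ π) := by
  refine card_cyc _ (fun d => (Quotient.mk _ (g⁻¹ d) : CycQ π)) ?_ ?_
  · intro d e
    rw [Equiv.Perm.sameCycle_conj]
    exact (Quotient.eq (r := Equiv.Perm.SameCycle.setoid π)).symm
  · intro x
    induction x using Quotient.inductionOn with | _ x
    exact ⟨g x, by simp⟩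

theorem pdata_of (h3 : ThreeConnectedGraph G) {σ : Equiv.Perm G.Dart}
    (hσ : IsPlanarEmbedding G σ) : PData G σ := by
  obtain ⟨⟨htail, hrot⟩, heul⟩ := hσ
  obtain ⟨h4, hc⟩ := h3
  have rot : ∀ d e : G.Dart, d.fst = e.fst → σ.SameCycle d e := by
    intro d e h
    obtain ⟨n, hn⟩ := hrot d e h
    exact ⟨n, by simpa using hn⟩
  have scf : ∀ d e : G.Dart, σ.SameCycle d e → d.fst = e.fst := fun d e h =>
    sameCycle_const (u := fun d : G.Dart => d.fst) htail h
  have conn3 : ∀ (v w : V) (H : V → Prop), (∀ x y, x ≠ v → x ≠ w → y ≠ v → y ≠ w → G.Adj x y →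
    (H x ↔ H y)) → ∀ x y, x ≠ v → x ≠ w → y ≠ v → y ≠ w → (H x ↔ H y) := by
    intro v w H hH x y hxv hxw hyv hyw
    have hcon := hc {v, w} (by
      have := Set.ncard_insert_le v {w}
      rwa [Set.ncard_singleton] at this)
    have := preconn_const hcon.preconnected (fun z => H z.1) (by
      rintro ⟨a, ha⟩ ⟨b, hb⟩ hab
      simp only [Set.mem_compl_iff, Set.mem_insert_iff, Set.mem_singleton_iff, not_or] at ha hb
      exact hH a b ha.1 ha.2 hb.1 hb.2 hab)
    exact this ⟨x, by simp [hxv, hxw]⟩ ⟨y, by simp [hyv, hyw]⟩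
  have conn : ∀ H : V → Prop, (∀ x y, G.Adj x y → (H x ↔ H y)) → ∀ x y, H x ↔ H y := by
    intro H hH x y
    have hcon := hc ∅ (by simp)
    have := preconn_const hcon.preconnected (fun z => H z.1) (by
      rintro ⟨a, ha⟩ ⟨b, hb⟩ hab
      exact hH a b hab)
    exact this ⟨x, by simp⟩ ⟨y, by simp⟩
  have avoid : ∀ a b c : V, ∃ d, d ≠ a ∧ d ≠ b ∧ d ≠ c := by
    intro a b c
    by_contra hcon
    push Not at hcon
    have : (Finset.univ : Finset V) ⊆ {a, b, c} := by
      intro d _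
      simp only [Finset.mem_insert, Finset.mem_singleton]
      by_contra hd
      push Not at hd
      exact hd.2.2 (hcon d hd.1 hd.2.1)
    have := (Finset.card_le_card this).trans Finset.card_le_three
    rw [Nat.card_eq_fintype_card] at h4
    rw [Finset.card_univ] at this
    omega
  have out : ∀ v : V, ∃ d : G.Dart, d.fst = v := by
    intro v
    by_contra hno
    push Not at hno
    obtain ⟨w, hw, -, -⟩ := avoid v v v
    have := conn (fun x => x = v) (by
      intro x y hxy
      constructor
      · intro h; exact absurd h (hno ⟨(x, y), hxy⟩)
      · intro h; exact absurd h (hno ⟨(y, x), hxy.symm⟩)) v w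
    exact hw (this.1 rfl)
  have deg : ∀ d : G.Dart, σ (σ d) ≠ d := by
    intro d hd
    have hall : ∀ e : G.Dart, e.fst = d.fst → e = d ∨ e = σ d := by
      intro e he
      obtain ⟨n, rfl⟩ := hrot d e he.symm
      clear he
      induction n with
      | zero => left; rfl
      | succ n ih =>
        rw [pow_succ', Equiv.Perm.mul_apply]
        rcases ih with h | h <;> rw [h]
        · right; rfl
        · left; exact hd
    obtain ⟨w, hw1, hw2, hw3⟩ := avoid d.fst d.snd (σ d).snd
    have hadj : ∀ y, G.Adj d.fst y → y = d.snd ∨ y = (σ d).snd := by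
      intro y hy
      rcases hall ⟨(d.fst, y), hy⟩ rfl with h | h
      · left; rw [← h]
      · right; rw [← h]
    have := conn3 d.snd (σ d).snd (fun x => x = d.fst) (by
      intro x y hx1 hx2 hy1 hy2 hxy
      constructor
      · intro h
        subst h
        rcases hadj y hxy with h | h
        · exact absurd h hy1
        · exact absurd h hy2
      · intro h
        subst h
        rcases hadj x hxy.symm with h | h
        · exact absurd h hx1
        · exact absurd h hx2) d.fst w d.fst_ne_snd
        (by
          have := (σ d).fst_ne_snd
          have h2 : (σ d).fst = d.fst := htail d
          rwa [h2] at this) hw2 hw3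
    exact hw1 (this.1 rfl)
  refine ⟨htail, rot, ?_, conn, conn3, deg, out⟩
  have e1 : Nat.card (CycQ σ) = Nat.card V :=
    card_cyc σ (fun d => d.fst) (fun d e => ⟨scf d e, rot d e⟩) out
  have e2 : Nat.card (CycQ (dartRev G)) = Nat.card G.edgeSet := by
    refine card_cyc _ (fun d => (⟨d.edge, d.edge_mem⟩ : G.edgeSet)) ?_ ?_
    · intro d e
      rw [Subtype.mk.injEq, dart_edge_eq_iff]
      constructor
      · intro h
        have := sameCycle_const (π := dartRev G) (u := fun d : G.Dart => d.edge)
          (fun d => Dart.edge_symm d) h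
        exact (dart_edge_eq_iff d e).1 this
      · rintro (rfl | rfl)
        · exact Equiv.Perm.SameCycle.refl _ _
        · exact ⟨1, by rw [zpow_one]; exact dartRev_rev e⟩
    · rintro ⟨e, he⟩
      induction e using Sym2.ind with | _ x y
      exact ⟨⟨(x, y), he⟩, rfl⟩
  have e3 : Nat.card (CycQ (σ * dartRev G)) = faceCount G σ := rfl
  have e4 : Nat.card G.Dart = 2 * Nat.card G.edgeSet := by
    rw [Nat.card_eq_fintype_card, dart_card_eq_twice_card_edges, Nat.card_eq_fintype_card,
      ← edgeFinset_card]
  rw [e1, e2, e3, e4]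
  omega

/-- the action of a graph automorphism on darts -/
def dartPerm (φ : G ≃g G) : Equiv.Perm G.Dart where
  toFun d := ⟨(φ d.fst, φ d.snd), φ.map_adj_iff.2 d.adj⟩
  invFun d := ⟨(φ.symm d.fst, φ.symm d.snd), φ.symm.map_adj_iff.2 d.adj⟩
  left_inv d := dart_eq (φ.symm_apply_apply _) (φ.symm_apply_apply _)
  right_inv d := dart_eq (φ.apply_symm_apply _) (φ.apply_symm_apply _)

theorem dartPerm_fst (φ : G ≃g G) (d : G.Dart) : (dartPerm φ d).fst = φ d.fst := rfl

theorem dartPerm_inv_fst (φ : G ≃g G) (d : G.Dart) :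
    ((dartPerm φ)⁻¹ d).fst = φ.symm d.fst := rfl

theorem dartPerm_comm (φ : G ≃g G) : Commute (dartPerm φ) (dartRev G) := by
  ext d <;> rfl

theorem PData.conj {σ : Equiv.Perm G.Dart} (hP : PData G σ) (φ : G ≃g G) :
    PData G (dartPerm φ * σ * (dartPerm φ)⁻¹) := by
  refine ⟨?_, ?_, ?_, hP.conn, hP.conn3, ?_, hP.out⟩
  · intro d
    rw [Equiv.Perm.mul_apply, Equiv.Perm.mul_apply, dartPerm_fst, hP.tail, dartPerm_inv_fst]
    exact φ.apply_symm_apply _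
  · intro d e h
    rw [Equiv.Perm.sameCycle_conj]
    apply hP.rot
    rw [dartPerm_inv_fst, dartPerm_inv_fst, h]
  · have h := hP.eul
    have : dartPerm φ * σ * (dartPerm φ)⁻¹ * dartRev G
        = dartPerm φ * (σ * dartRev G) * (dartPerm φ)⁻¹ := by
      have := (dartPerm_comm φ).inv_left.eq
      rw [mul_assoc, this]; group
    rw [this, card_cyc_conj, card_cyc_conj]
    exact h
  · intro d h
    apply hP.deg ((dartPerm φ)⁻¹ d)
    have := congrArg (fun x => (dartPerm φ)⁻¹ x) h
    simpa using this

theorem final_inj {σ : Equiv.Perm G.Dart} (hP : PData G σ) {D : Set V} (hD : 3 ≤ D.ncard)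
    (φ ψ : G ≃g G) (hφ : ∀ v ∈ D, φ v = v) (hψ : ∀ v ∈ D, ψ v = v)
    (h : dartPerm φ * σ * (dartPerm φ)⁻¹ = dartPerm ψ * σ * (dartPerm ψ)⁻¹) : φ = ψ := by
  obtain ⟨x, y, z, hx, hy, hz, hxy, hxz, hyz⟩ := (Set.two_lt_ncard_iff (Set.toFinite D)).1 hD
  obtain ⟨d0, h0⟩ := hP.out x
  obtain ⟨d1, h1⟩ := hP.out y
  obtain ⟨d2, h2⟩ := hP.out z
  have key : (dartPerm ψ)⁻¹ * dartPerm φ = 1 := by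
    refine rigid σ (dartRev G) _ hP.trans hP.eul ?_
      ((dartPerm_comm ψ).inv_left.mul_left (dartPerm_comm φ)) ![d0, d1, d2] ?_ ?_
    · show _ = _
      calc (dartPerm ψ)⁻¹ * dartPerm φ * σ
          = (dartPerm ψ)⁻¹ * (dartPerm φ * σ * (dartPerm φ)⁻¹) * dartPerm φ := by group
        _ = σ * ((dartPerm ψ)⁻¹ * dartPerm φ) := by rw [h]; group
    · have aux : ∀ d : G.Dart, d.fst ∈ D → σ.SameCycle d (((dartPerm ψ)⁻¹ * dartPerm φ) d) := by
        intro d hd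
        apply hP.rot
        rw [Equiv.Perm.mul_apply, dartPerm_inv_fst, dartPerm_fst, hφ _ hd]
        exact ((RelIso.symm_apply_eq ψ).2 (hψ _ hd).symm).symm
      intro i
      fin_cases i
      · exact aux d0 (h0 ▸ hx)
      · exact aux d1 (h1 ▸ hy)
      · exact aux d2 (h2 ▸ hz)
    · intro i j hij
      rw [hP.sc_iff] at hij
      have := hxy.symm
      have := hxz.symm
      have := hyz.symm
      fin_cases i <;> fin_cases j <;> simp_all
  have key2 : dartPerm φ = dartPerm ψ := (inv_mul_eq_one.1 key).symm
  ext v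
  obtain ⟨d, rfl⟩ := hP.out v
  rw [← dartPerm_fst, key2, dartPerm_fst]

end final

/-- Let `G` be a 3-connected planar graph with at least 3 vertices each given a
distinct color (i.e., a set `D` of at least 3 distinguished vertices which every
color-preserving automorphism must fix pointwise). Then the group of color-preserving
automorphisms of `G` has order at most 2, i.e., `G` has at most one non-trivial
color-preserving automorphism. -/
theorem threeconnected_three_fixed_colors_automorphism_bound {V : Type*} [Fintype V]
    (G : SimpleGraph V)
    (h3 : ThreeConnectedGraph G) (hpl : HasPlanarEmbedding G)
    (D : Set V) (hD : 3 ≤ D.ncard) :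
    Nat.card {φ : G ≃g G // ∀ v ∈ D, φ v = v} ≤ 2 := by
  classical
  obtain ⟨σ, hσ⟩ := hpl
  have hP := pdata_of h3 hσ
  have : Nat.card {φ : G ≃g G // ∀ v ∈ D, φ v = v} ≤ Nat.card Bool := by
    refine Nat.card_le_card_of_injective
      (fun φ => decide (dartPerm φ.1 * σ * (dartPerm φ.1)⁻¹ = σ)) ?_
    rintro ⟨φ, hφ⟩ ⟨ψ, hψ⟩ heq
    simp only [decide_eq_decide] at heq
    refine Subtype.ext (final_inj hP hD φ ψ hφ hψ ?_)
    rcases hP.whitney (hP.conj φ) with h1 | h1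
    · rw [h1, heq.1 h1]
    · rcases hP.whitney (hP.conj ψ) with h2 | h2
      · rw [h2, heq.2 h2]
      · rw [h1, h2]
  simpa using this
end
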